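/- Let α = p/q + Σ_{j=2}^∞ (−1)^j/x_j. Then α is transcendental, and its irrationality exponent satisfies μ(α) ≥ (3 + √5)/2. -/

import Mathlib

/-- The set of "good rational approximations" `P/Q` (with `Q ≥ 1`) to `α` for exponent `μ`:
pairs `(P, Q)` with `0 < |α - P/Q| < 1/Q^μ`.  The irrationality exponent of `α` is the
supremum of the set of `μ` for which this set is infinite. -/
def approxSet (α μ : ℝ) : Set (ℤ × ℤ) :=
  {PQ | 1 ≤ PQ.2 ∧ 0 < |α - (PQ.1 : ℝ) / (PQ.2 : ℝ)| ∧
    |α - (PQ.1 : ℝ) / (PQ.2 : ℝ)| < 1 / (PQ.2 : ℝ) ^ μ}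

section RothTheorem

open MvPolynomial Finset

/-- The product of binomial coefficients `∏ i, (k i).choose (j i)`. -/
def finsuppChoose (k j : ℕ →₀ ℕ) : ℕ := ∏ i ∈ j.support, (k i).choose (j i)

lemma finsuppChoose_eq_prod {k j : ℕ →₀ ℕ} {S : Finset ℕ} (h : j.support ⊆ S) :
    finsuppChoose k j = ∏ i ∈ S, (k i).choose (j i) := by
  refine Finset.prod_subset h fun i _ hi => ?_
  simp [Finsupp.notMem_support_iff.mp hi]

@[simp] lemma finsuppChoose_zero (k : ℕ →₀ ℕ) : finsuppChoose k 0 = 1 := by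
  simp [finsuppChoose]

@[simp] lemma finsuppChoose_self (k : ℕ →₀ ℕ) : finsuppChoose k k = 1 := by
  simp [finsuppChoose]

lemma finsuppChoose_eq_zero {k j : ℕ →₀ ℕ} (h : ¬ j ≤ k) : finsuppChoose k j = 0 := by
  rw [Finsupp.le_def] at h
  push Not at h
  obtain ⟨i, hi⟩ := h
  refine Finset.prod_eq_zero (i := i) ?_ (Nat.choose_eq_zero_of_lt hi)
  simp; omega

lemma finsuppChoose_le (k j : ℕ →₀ ℕ) {n : ℕ} {d : ℕ → ℕ} (hk : ∀ i, k i ≤ d i)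
    (hk0 : ∀ i, n ≤ i → k i = 0) :
    finsuppChoose k j ≤ 2 ^ ∑ i ∈ range n, d i := by
  by_cases h : j ≤ k
  · have : j.support ⊆ range n := by
      intro i hi
      simp only [mem_range]
      by_contra hn
      have := hk0 i (by omega)
      have := Finsupp.le_def.mp h i
      simp at hi
      omega
    rw [finsuppChoose_eq_prod this, ← Finset.prod_pow_eq_pow_sum]
    refine Finset.prod_le_prod' fun i _ => ?_
    exact (Nat.choose_le_two_pow _ _).trans (Nat.pow_le_pow_right (by norm_num) (hk i))
  · rw [finsuppChoose_eq_zero h]; positivity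

lemma finsuppChoose_add_single_mul (k j : ℕ →₀ ℕ) (i : ℕ) :
    finsuppChoose k (j + Finsupp.single i 1) * (j i + 1) = finsuppChoose k j * (k i - j i) := by
  set S := insert i j.support
  have h1 : (j + Finsupp.single i 1).support ⊆ S := by
    intro l hl
    by_cases h : l = i <;> simp_all [S, Finsupp.single_apply, eq_comm]
  have h2 : j.support ⊆ S := by intro l hl; simp_all [S]
  have hi : i ∈ S := by simp [S]
  rw [finsuppChoose_eq_prod h1, finsuppChoose_eq_prod h2, ← Finset.mul_prod_erase _ _ hi,
    ← Finset.mul_prod_erase _ _ hi]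
  have : ∀ l ∈ S.erase i, (k l).choose ((j + Finsupp.single i 1 : ℕ →₀ ℕ) l) = (k l).choose (j l) := by
    intro l hl
    have : i ≠ l := (Finset.ne_of_mem_erase hl).symm
    simp [this]
  rw [Finset.prod_congr rfl this]
  have := Nat.choose_succ_right_eq (k i) (j i)
  simp only [Finsupp.add_apply, Finsupp.single_eq_same]
  rw [mul_right_comm, this]; ring

section Hasse

variable {R : Type*} [CommRing R]

/-- The Hasse derivative of a multivariate polynomial. -/
noncomputable def hasse (j : ℕ →₀ ℕ) (P : MvPolynomial ℕ R) : MvPolynomial ℕ R :=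
  ∑ k ∈ P.support, monomial (k - j) ((finsuppChoose k j : R) * coeff k P)

lemma coeff_hasse (j k : ℕ →₀ ℕ) (P : MvPolynomial ℕ R) :
    coeff k (hasse j P) = (finsuppChoose (k + j) j : R) * coeff (k + j) P := by
  classical
  rw [hasse, coeff_sum]
  simp only [coeff_monomial]
  rw [Finset.sum_eq_single (k + j)]
  · simp
  · intro l _ hl
    split_ifs with h
    · have : ¬ j ≤ l := by
        intro hjl
        apply hl
        rw [← h, tsub_add_cancel_of_le hjl]
      simp [finsuppChoose_eq_zero this]
    · rfl
  · intro h
    simp [notMem_support_iff.mp h]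

@[simp] lemma hasse_zero_left (P : MvPolynomial ℕ R) : hasse 0 P = P := by
  ext k; simp [coeff_hasse]

lemma hasse_sum {ι : Type*} (s : Finset ι) (j : ℕ →₀ ℕ) (f : ι → MvPolynomial ℕ R) :
    hasse j (∑ i ∈ s, f i) = ∑ i ∈ s, hasse j (f i) := by
  ext k; simp [coeff_hasse, coeff_sum, Finset.mul_sum]

lemma hasse_map {S : Type*} [CommRing S] (f : R →+* S) (j : ℕ →₀ ℕ) (P : MvPolynomial ℕ R) :
    hasse j (map f P) = map f (hasse j P) := by
  ext k; simp [coeff_hasse, coeff_map]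

lemma hasse_add_single (j : ℕ →₀ ℕ) (i : ℕ) (P : MvPolynomial ℕ R) :
    C ((j i : R) + 1) * hasse (j + Finsupp.single i 1) P = pderiv i (hasse j P) := by
  ext k
  rw [coeff_C_mul, coeff_pderiv, coeff_hasse, coeff_hasse, ← add_assoc, add_right_comm k j]
  have := finsuppChoose_add_single_mul (k + Finsupp.single i 1 + j) j i
  have h2 : (k + Finsupp.single i 1 + j : ℕ →₀ ℕ) i - j i = k i + 1 := by simp
  rw [h2] at this
  have h3 := congrArg (Nat.cast (R := R)) this
  push_cast at h3
  linear_combination coeff (k + Finsupp.single i 1 + j) P * h3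

/-- Induction over multi-indices by adding one unit at a time. -/
lemma finsupp_nat_induction {motive : (ℕ →₀ ℕ) → Prop} (zero : motive 0)
    (step : ∀ j i, motive j → motive (j + Finsupp.single i 1)) (j : ℕ →₀ ℕ) : motive j := by
  induction h : j.degree generalizing j with
  | zero => rw [Finsupp.degree_eq_zero_iff] at h; rwa [h]
  | succ n ih =>
    have : j ≠ 0 := by rintro rfl; simp at h
    obtain ⟨i, hi⟩ := Finsupp.ne_iff.mp this
    have hle : Finsupp.single i 1 ≤ j := by
      rw [Finsupp.single_le_iff]; simp at hi; omega
    rw [← tsub_add_cancel_of_le hle]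
    refine step _ _ (ih _ ?_)
    have := congrArg Finsupp.degree (tsub_add_cancel_of_le hle)
    simp only [map_add, Finsupp.degree_single] at this
    omega

/-- The translation `X i ↦ X i + a i`. -/
noncomputable def shift (a : ℕ → R) : MvPolynomial ℕ R →ₐ[R] MvPolynomial ℕ R :=
  aeval fun i => X i + C (a i)

lemma pderiv_shift (a : ℕ → R) (i : ℕ) (P : MvPolynomial ℕ R) :
    pderiv i (shift a P) = shift a (pderiv i P) := by
  classical
  induction P using MvPolynomial.induction_on with
  | C r => simp [shift]
  | add p q hp hq => simp [hp, hq]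
  | mul_X p l hp =>
    rw [map_mul, pderiv_mul, pderiv_mul, hp]
    simp only [map_add, map_mul, shift, aeval_X, pderiv_C, pderiv_X, add_zero]
    by_cases h : i = l <;> simp [h, eq_comm]

lemma constantCoeff_shift (a : ℕ → R) (P : MvPolynomial ℕ R) :
    coeff 0 (shift a P) = eval a P := by
  rw [← constantCoeff_eq]
  induction P using MvPolynomial.induction_on with
  | C r => simp [shift]
  | add p q hp hq => simp [hp, hq]
  | mul_X p l hp => rw [map_mul, map_mul, hp]; simp [shift]

lemma shift_shift (a b : ℕ → R) (P : MvPolynomial ℕ R) :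
    shift a (shift b P) = shift (a + b) P := by
  induction P using MvPolynomial.induction_on with
  | C r => simp [shift]
  | add p q hp hq => simp [hp, hq]
  | mul_X p l hp =>
    rw [map_mul, map_mul, map_mul, hp]; simp [shift]; ring

end Hasse

section HasseField

variable {K : Type*} [Field K] [CharZero K]

lemma hasse_shift (a : ℕ → K) (j : ℕ →₀ ℕ) (P : MvPolynomial ℕ K) :
    hasse j (shift a P) = shift a (hasse j P) := by
  induction j using finsupp_nat_induction with
  | zero => simp
  | step j i ih =>
    have h : (C ((j i : K) + 1) : MvPolynomial ℕ K) ≠ 0 := by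
      rw [Ne, C_eq_zero]; exact Nat.cast_add_one_ne_zero _
    apply mul_left_cancel₀ h
    rw [hasse_add_single, ih, pderiv_shift, ← hasse_add_single, map_mul]
    simp [shift]

lemma coeff_shift (a : ℕ → K) (j : ℕ →₀ ℕ) (P : MvPolynomial ℕ K) :
    coeff j (shift a P) = eval a (hasse j P) := by
  rw [← constantCoeff_shift, ← hasse_shift, coeff_hasse]
  simp

lemma hasse_mul_of_pderiv_eq_zero {j : ℕ →₀ ℕ} {P : MvPolynomial ℕ K}
    (h : ∀ i ∈ j.support, pderiv i P = 0) (Q : MvPolynomial ℕ K) :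
    hasse j (P * Q) = P * hasse j Q := by
  induction j using finsupp_nat_induction with
  | zero => simp
  | step j i ih =>
    have hC : (C ((j i : K) + 1) : MvPolynomial ℕ K) ≠ 0 := by
      rw [Ne, C_eq_zero]; exact Nat.cast_add_one_ne_zero _
    apply mul_left_cancel₀ hC
    rw [hasse_add_single, ih, pderiv_mul, h i (by simp), mul_left_comm, hasse_add_single]
    · simp
    · intro l hl
      refine h l ?_
      simp at hl ⊢
      intro h
      omega

end HasseField

section LOne

variable {R : Type*} [CommRing R] [LinearOrder R] [IsStrictOrderedRing R]

/-- The sum of the absolute values of the coefficients. -/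
noncomputable def lOne (P : MvPolynomial ℕ R) : R := ∑ k ∈ P.support, |coeff k P|

lemma lOne_eq_sum {P : MvPolynomial ℕ R} {S : Finset (ℕ →₀ ℕ)} (h : P.support ⊆ S) :
    lOne P = ∑ k ∈ S, |coeff k P| := by
  refine Finset.sum_subset h fun k _ hk => ?_
  simp [notMem_support_iff.mp hk]

lemma lOne_nonneg (P : MvPolynomial ℕ R) : 0 ≤ lOne P := Finset.sum_nonneg fun _ _ => abs_nonneg _

@[simp] lemma lOne_zero : lOne (0 : MvPolynomial ℕ R) = 0 := by simp [lOne]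

lemma abs_coeff_le_lOne (k : ℕ →₀ ℕ) (P : MvPolynomial ℕ R) : |coeff k P| ≤ lOne P := by
  by_cases h : k ∈ P.support
  · exact Finset.single_le_sum (f := fun k => |coeff k P|) (fun _ _ => abs_nonneg _) h
  · rw [notMem_support_iff.mp h, abs_zero]; exact lOne_nonneg P

lemma lOne_add_le (P Q : MvPolynomial ℕ R) : lOne (P + Q) ≤ lOne P + lOne Q := by
  classical
  rw [lOne_eq_sum (S := P.support ∪ Q.support) (P := P + Q) support_add,
    lOne_eq_sum (P := P) (S := P.support ∪ Q.support) subset_union_left,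
    lOne_eq_sum (P := Q) (S := P.support ∪ Q.support) subset_union_right, ← sum_add_distrib]
  exact Finset.sum_le_sum fun k _ => by rw [coeff_add]; exact abs_add_le _ _

lemma lOne_sum_le {ι : Type*} (s : Finset ι) (f : ι → MvPolynomial ℕ R) :
    lOne (∑ i ∈ s, f i) ≤ ∑ i ∈ s, lOne (f i) :=
  Finset.le_sum_of_subadditive lOne lOne_zero.le lOne_add_le s f

lemma lOne_monomial_mul_le (k : ℕ →₀ ℕ) (a : R) (Q : MvPolynomial ℕ R) :
    lOne (monomial k a * Q) ≤ |a| * lOne Q := by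
  classical
  have : (monomial k a * Q).support ⊆ Q.support.map (addLeftEmbedding k) := by
    intro l hl
    rw [mem_support_iff, coeff_monomial_mul'] at hl
    split_ifs at hl with h
    · simp only [mem_map, addLeftEmbedding_apply]
      exact ⟨l - k, mem_support_iff.mpr (right_ne_zero_of_mul hl), add_tsub_cancel_of_le h⟩
    · simp at hl
  rw [lOne_eq_sum this, sum_map, lOne, mul_sum]
  refine Finset.sum_le_sum fun l _ => ?_
  rw [addLeftEmbedding_apply, coeff_monomial_mul, abs_mul]

lemma lOne_mul_le (P Q : MvPolynomial ℕ R) : lOne (P * Q) ≤ lOne P * lOne Q := by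
  conv_lhs => rw [P.as_sum, Finset.sum_mul]
  refine (lOne_sum_le _ _).trans ?_
  rw [lOne, Finset.sum_mul]
  exact Finset.sum_le_sum fun k _ => lOne_monomial_mul_le _ _ _

lemma lOne_one : lOne (1 : MvPolynomial ℕ R) = 1 := by
  rw [lOne_eq_sum (S := {0})]
  · simp
  · rw [← C_1, C_apply]; exact support_monomial_subset

lemma lOne_neg (P : MvPolynomial ℕ R) : lOne (-P) = lOne P := by
  simp [lOne, support_neg]

lemma lOne_pos {P : MvPolynomial ℕ R} (h : P ≠ 0) : 0 < lOne P := by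
  obtain ⟨k, hk⟩ := ne_zero_iff.mp h
  exact (abs_pos.mpr hk).trans_le (abs_coeff_le_lOne k P)

lemma lOne_prod_le {ι : Type*} (s : Finset ι) (f : ι → MvPolynomial ℕ R) :
    lOne (∏ i ∈ s, f i) ≤ ∏ i ∈ s, lOne (f i) := by
  classical
  induction s using Finset.induction_on with
  | empty => simp [lOne_one]
  | insert i s hi ih =>
    rw [prod_insert hi, prod_insert hi]
    exact (lOne_mul_le _ _).trans (mul_le_mul_of_nonneg_left ih (lOne_nonneg _))

lemma lOne_det_le {s : ℕ} (M : Matrix (Fin s) (Fin s) (MvPolynomial ℕ R)) {b : R}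
    (h : ∀ i j, lOne (M i j) ≤ b) : lOne M.det ≤ s.factorial * b ^ s := by
  rw [Matrix.det_apply]
  refine (lOne_sum_le _ _).trans ?_
  have : ∀ σ ∈ (univ : Finset (Equiv.Perm (Fin s))),
      lOne (Equiv.Perm.sign σ • ∏ i, M (σ i) i) ≤ b ^ s := by
    intro σ _
    have h1 : lOne (Equiv.Perm.sign σ • ∏ i, M (σ i) i) = lOne (∏ i, M (σ i) i) := by
      rcases Int.units_eq_one_or (Equiv.Perm.sign σ) with h | h <;> simp [h, lOne_neg]
    rw [h1]
    refine (lOne_prod_le _ _).trans ?_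
    refine (Finset.prod_le_prod (fun i _ => lOne_nonneg _) fun i _ => h (σ i) i).trans ?_
    simp
  refine (Finset.sum_le_sum this).trans ?_
  simp [Fintype.card_perm]

lemma lOne_hasse_le (j : ℕ →₀ ℕ) {P : MvPolynomial ℕ R} {n : ℕ} {d : ℕ → ℕ}
    (hP : ∀ k ∈ P.support, (∀ i, n ≤ i → k i = 0) ∧ ∀ i, k i ≤ d i) :
    lOne (hasse j P) ≤ 2 ^ (∑ i ∈ range n, d i) * lOne P := by
  rw [hasse, lOne, lOne, mul_sum]
  refine (lOne_sum_le _ _).trans (Finset.sum_le_sum fun k hk => ?_)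
  have := lOne_monomial_mul_le (k - j) ((finsuppChoose k j : R) * coeff k P) 1
  rw [mul_one, lOne_one, mul_one, abs_mul, Nat.abs_cast] at this
  refine this.trans (mul_le_mul_of_nonneg_right ?_ (abs_nonneg _))
  exact_mod_cast finsuppChoose_le k j (hP k hk).2 (hP k hk).1

lemma lOne_map_intCast {S : Type*} [CommRing S] [LinearOrder S] [IsStrictOrderedRing S]
    (P : MvPolynomial ℕ ℤ) : lOne (map (Int.castRingHom S) P) = ((lOne P : ℤ) : S) := by
  rw [lOne_eq_sum (support_map_subset _ _), lOne]
  simp [coeff_map]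

lemma lOne_shift_le {P : MvPolynomial ℕ R} {n : ℕ} {d : ℕ → ℕ} {a : ℕ → R} {b : R}
    (hb : ∀ i, 1 + |a i| ≤ b)
    (hP : ∀ k ∈ P.support, (∀ i, n ≤ i → k i = 0) ∧ ∀ i, k i ≤ d i) :
    lOne (shift a P) ≤ b ^ (∑ i ∈ range n, d i) * lOne P := by
  have hb1 : 1 ≤ b := (le_add_of_nonneg_right (abs_nonneg (a 0))).trans (hb 0)
  conv_lhs => rw [P.as_sum, map_sum]
  refine (lOne_sum_le _ _).trans ?_
  rw [lOne, mul_sum]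
  refine Finset.sum_le_sum fun k hk => ?_
  obtain ⟨hk0, hkd⟩ := hP k hk
  have hX : ∀ i, lOne (X i + C (a i)) ≤ b := by
    intro i
    refine (lOne_add_le _ _).trans (le_trans ?_ (hb i))
    have h1 := lOne_monomial_mul_le (Finsupp.single i 1) (1 : R) 1
    have h2 := lOne_monomial_mul_le 0 (a i) 1
    rw [mul_one, lOne_one, mul_one] at h1 h2
    rw [abs_one] at h1
    exact add_le_add h1 h2
  have hs : shift a (monomial k (coeff k P)) =
      monomial 0 (coeff k P) * ∏ i ∈ range n, (X i + C (a i)) ^ k i := by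
    rw [shift, aeval_monomial, Finsupp.prod_of_support_subset (s := range n)]
    · rfl
    · intro i hi
      by_contra h
      simp at hi h
      exact hi (hk0 i h)
    · simp
  rw [hs]
  refine (lOne_monomial_mul_le _ _ _).trans ?_
  rw [mul_comm]
  refine mul_le_mul_of_nonneg_right ?_ (abs_nonneg _)
  refine (lOne_prod_le _ _).trans ?_
  rw [← Finset.prod_pow_eq_pow_sum]
  refine Finset.prod_le_prod (fun _ _ => lOne_nonneg _) fun i _ => ?_
  have : ∀ e, lOne ((X i + C (a i)) ^ e) ≤ b ^ e := by
    intro e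
    have := lOne_prod_le (range e) fun _ => X i + C (a i)
    simp only [prod_const, card_range] at this
    exact this.trans (pow_le_pow_left₀ (lOne_nonneg _) (hX i) e)
  exact (this _).trans (pow_le_pow_right₀ hb1 (hkd i))

end LOne

section Wronskian

/-- The Euler operator `X * d/dX` on univariate polynomials. -/
noncomputable def euler : Module.End ℚ (Polynomial ℚ) :=
  (LinearMap.mulLeft ℚ Polynomial.X).comp Polynomial.derivative

lemma coeff_euler_pow (l n : ℕ) (p : Polynomial ℚ) :
    ((euler ^ l) p).coeff n = (n : ℚ) ^ l * p.coeff n := by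
  induction l generalizing p with
  | zero => simp
  | succ l ih =>
    rw [pow_succ, Module.End.mul_apply, ih, pow_succ, mul_assoc]
    congr 1
    cases n with
    | zero => simp [euler]
    | succ n =>
      simp only [euler, LinearMap.comp_apply, LinearMap.mulLeft_apply, Polynomial.coeff_X_mul,
        Polynomial.coeff_derivative]
      push_cast; ring

lemma natDegree_euler_pow_le (l : ℕ) (p : Polynomial ℚ) :
    ((euler ^ l) p).natDegree ≤ p.natDegree := by
  rw [Polynomial.natDegree_le_iff_coeff_eq_zero]
  intro n hn
  rw [coeff_euler_pow, Polynomial.coeff_eq_zero_of_natDegree_lt hn, mul_zero]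

lemma coeff_prod_sum_of_natDegree_le {ι : Type*} (s : Finset ι) (f : ι → Polynomial ℚ) (e : ι → ℕ)
    (h : ∀ i ∈ s, (f i).natDegree ≤ e i) :
    (∏ i ∈ s, f i).coeff (∑ i ∈ s, e i) = ∏ i ∈ s, (f i).coeff (e i) ∧
      (∏ i ∈ s, f i).natDegree ≤ ∑ i ∈ s, e i := by
  classical
  induction s using Finset.induction_on with
  | empty => simp
  | insert i s hi ih =>
    obtain ⟨h1, h2⟩ := ih fun j hj => h j (mem_insert_of_mem hj)
    have h3 := h i (mem_insert_self _ _)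
    rw [prod_insert hi, prod_insert hi, sum_insert hi]
    refine ⟨?_, Polynomial.natDegree_mul_le_of_le h3 h2⟩
    rw [Polynomial.coeff_mul_add_eq_of_natDegree_le h3 h2, h1]

/-- Linearly independent polynomials have nonvanishing Euler-Wronskian. -/
lemma det_euler_ne_zero {s : ℕ} (ψ : Fin s → Polynomial ℚ)
    (h : ∀ c : Fin s → ℚ, ∑ j, c j • ψ j = 0 → c = 0) :
    (Matrix.of fun l j : Fin s => (euler ^ (l : ℕ)) (ψ j)).det ≠ 0 := by
  classical
  induction hN : ∑ j, (if ψ j = 0 then 0 else (ψ j).natDegree + 1)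
    using Nat.strong_induction_on generalizing ψ with
  | _ N ih =>
  have hne : ∀ j, ψ j ≠ 0 := by
    intro j hj
    have := h (Pi.single j 1) (by simp [Pi.single_apply, hj])
    simpa using congrFun this j
  by_cases hinj : Function.Injective fun j => (ψ j).natDegree
  · intro h0
    have h1 := congrArg (fun p => Polynomial.coeff p (∑ j, (ψ j).natDegree)) h0
    simp only [Matrix.det_apply, Matrix.of_apply, Polynomial.finsetSum_coeff,
      Polynomial.coeff_zero] at h1
    have h2 : ∀ σ : Equiv.Perm (Fin s), (Equiv.Perm.sign σ • ∏ i,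
        (euler ^ (σ i : ℕ)) (ψ i)).coeff (∑ j, (ψ j).natDegree) =
        Equiv.Perm.sign σ • ∏ i, (((ψ i).natDegree : ℚ) ^ (σ i : ℕ) * (ψ i).leadingCoeff) := by
      intro σ
      have : (∏ i, (euler ^ (σ i : ℕ)) (ψ i)).coeff (∑ j, (ψ j).natDegree) =
          ∏ i, (((ψ i).natDegree : ℚ) ^ (σ i : ℕ) * (ψ i).leadingCoeff) := by
        rw [(coeff_prod_sum_of_natDegree_le _ _ _ fun i _ => natDegree_euler_pow_le _ _).1]
        simp [coeff_euler_pow]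
      rcases Int.units_eq_one_or (Equiv.Perm.sign σ) with h | h <;> simp [h, this]
    simp only [h2] at h1
    replace h1 : (Matrix.of fun l j : Fin s =>
        (((ψ j).natDegree : ℚ) ^ (l : ℕ) * (ψ j).leadingCoeff)).det = 0 := by
      rw [Matrix.det_apply, ← h1]
      simp only [Matrix.of_apply]
    have h3 : (Matrix.of fun l j : Fin s =>
        (((ψ j).natDegree : ℚ) ^ (l : ℕ) * (ψ j).leadingCoeff)) =
        Matrix.of fun l j => (fun j => (ψ j).leadingCoeff) j *
          (Matrix.vandermonde fun j => ((ψ j).natDegree : ℚ)).transpose l j := by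
      ext l j; simp [Matrix.vandermonde_apply, mul_comm]
    rw [h3, Matrix.det_mul_row, Matrix.det_transpose, mul_eq_zero] at h1
    rcases h1 with h1 | h1
    · rw [Finset.prod_eq_zero_iff] at h1
      obtain ⟨j, _, hj⟩ := h1
      exact hne j (Polynomial.leadingCoeff_eq_zero.mp hj)
    · refine (Matrix.det_vandermonde_ne_zero_iff.mpr ?_) h1
      intro i j hij
      exact hinj (Nat.cast_injective hij)
  · simp only [Function.Injective, not_forall] at hinj
    obtain ⟨i, j, hd, hij⟩ := hinj
    set c : ℚ := -((ψ i).leadingCoeff / (ψ j).leadingCoeff) with hc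
    have hlc : (ψ j).leadingCoeff ≠ 0 := by simpa using hne j
    have hlci : (ψ i).leadingCoeff ≠ 0 := by simpa using hne i
    have hc0 : c ≠ 0 := by rw [hc]; exact neg_ne_zero.mpr (div_ne_zero hlci hlc)
    set ψ' := Function.update ψ i (ψ i + c • ψ j) with hψ'
    have hsum : ∀ b : Fin s → ℚ, ∑ l, b l • ψ' l = ∑ l, (b + Pi.single j (b i * c) : Fin s → ℚ) l • ψ l := by
      intro b
      have e1 : ∀ l, b l • ψ' l = b l • ψ l + (Pi.single i ((b i * c) • ψ j) : Fin s → _) l := by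
        intro l
        by_cases hl : l = i
        · subst hl; simp [hψ', smul_add, smul_smul]
        · simp [hψ', hl]
      have e2 : ∀ l, (b + Pi.single j (b i * c) : Fin s → ℚ) l • ψ l =
          b l • ψ l + (Pi.single j ((b i * c) • ψ j) : Fin s → _) l := by
        intro l
        by_cases hl : l = j
        · subst hl; simp [add_smul]
        · simp [hl]
      simp only [e1, e2, sum_add_distrib, Finset.sum_pi_single']
      simp
    have h' : ∀ b : Fin s → ℚ, ∑ l, b l • ψ' l = 0 → b = 0 := by
      intro b hb
      rw [hsum] at hb
      have := h _ hb
      have hi : b i = 0 := by simpa [hij] using congrFun this i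
      rw [hi] at this
      simpa using this
    have hne' : ψ' i ≠ 0 := by
      intro hj
      have := h' (Pi.single i 1) (by simp [Pi.single_apply, hj])
      simpa using congrFun this i
    have hdeg : (ψ' i).natDegree < (ψ i).natDegree := by
      have e : ψ' i = ψ i + c • ψ j := by simp [hψ']
      refine lt_of_le_of_ne ?_ ?_
      · rw [e]
        refine Polynomial.natDegree_add_le_of_degree_le le_rfl ?_
        exact (Polynomial.natDegree_smul_le _ _).trans hd.ge
      · intro heq
        apply hne'
        rw [← Polynomial.leadingCoeff_eq_zero, Polynomial.leadingCoeff, heq, e]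
        have : (ψ j).coeff (ψ i).natDegree = (ψ j).leadingCoeff := by
          rw [Polynomial.leadingCoeff]; exact congrArg _ hd
        simp [this, hc]
        field_simp
        simp
    have hlt : ∑ l, (if ψ' l = 0 then 0 else (ψ' l).natDegree + 1) < N := by
      rw [← hN]
      refine Finset.sum_lt_sum (fun l _ => ?_) ⟨i, mem_univ _, ?_⟩
      · by_cases hl : l = i
        · subst hl
          rw [if_neg hne', if_neg (hne _)]; omega
        · simp [hψ', hl]
      · rw [if_neg hne', if_neg (hne _)]; omega
    have := ih _ hlt ψ' h' rfl
    convert this using 1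
    have hM : (Matrix.of fun l j : Fin s => (euler ^ (l : ℕ)) (ψ' j)) =
        (Matrix.of fun l j : Fin s => (euler ^ (l : ℕ)) (ψ j)).updateCol i fun l =>
          (Matrix.of fun l j : Fin s => (euler ^ (l : ℕ)) (ψ j)) l i +
          Polynomial.C c • (Matrix.of fun l j : Fin s => (euler ^ (l : ℕ)) (ψ j)) l j := by
      ext1 l m
      by_cases hm : m = i
      · subst hm
        simp [hψ', ← Polynomial.smul_eq_C_mul]
      · simp [hψ', hm]
    rw [hM, Matrix.det_updateCol_add_smul_self _ hij]

lemma MultilinearMap.exists_ne_zero_of_mem_span {s : ℕ} {M N : Type*} [AddCommGroup M] [Module ℚ M]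
    [AddCommGroup N] [Module ℚ N] (f : MultilinearMap ℚ (fun _ : Fin s => M) N) (v : Fin s → M)
    (G : Fin s → Set M) (hv : ∀ l, v l ∈ Submodule.span ℚ (G l)) (hf : f v ≠ 0) :
    ∃ g : Fin s → M, (∀ l, g l ∈ G l) ∧ f g ≠ 0 := by
  classical
  have key : ∀ S : Finset (Fin s), ∃ g : Fin s → M, (∀ l ∈ S, g l ∈ G l) ∧
      (∀ l ∉ S, g l = v l) ∧ f g ≠ 0 := by
    intro S
    induction S using Finset.induction_on with
    | empty => exact ⟨v, by simp, by simp, hf⟩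
    | insert i S hi ih =>
      obtain ⟨g, h1, h2, h3⟩ := ih
      have : ∃ x ∈ G i, f (Function.update g i x) ≠ 0 := by
        by_contra! hcon
        apply h3
        have : ∀ x ∈ Submodule.span ℚ (G i), f (Function.update g i x) = 0 := by
          intro x hx
          induction hx using Submodule.span_induction with
          | mem x hx => exact hcon x hx
          | zero => exact f.map_update_zero _ _
          | add x y _ _ hx hy => rw [f.map_update_add, hx, hy, add_zero]
          | smul a x _ hx => rw [f.map_update_smul, hx, smul_zero]
        have := this _ (hv i)
        rwa [← h2 i hi, Function.update_eq_self] at this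
      obtain ⟨x, hx, hfx⟩ := this
      refine ⟨Function.update g i x, ?_, ?_, hfx⟩
      · intro l hl
        by_cases h : l = i
        · subst h; simpa
        · simpa [h] using h1 l (by simpa [h] using hl)
      · intro l hl
        simp only [mem_insert, not_or] at hl
        simpa [hl.1] using h2 l hl.2
  obtain ⟨g, h1, _, h3⟩ := key univ
  exact ⟨g, fun l => h1 l (mem_univ _), h3⟩

/-- The polynomial obtained by multiplying the coefficient of `X ^ k` by `g k`. -/
noncomputable def diagMul (g : (ℕ →₀ ℕ) → ℚ) (P : MvPolynomial ℕ ℚ) : MvPolynomial ℕ ℚ :=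
  ∑ k ∈ P.support, monomial k (g k * coeff k P)

lemma coeff_diagMul (g : (ℕ →₀ ℕ) → ℚ) (P : MvPolynomial ℕ ℚ) (k : ℕ →₀ ℕ) :
    coeff k (diagMul g P) = g k * coeff k P := by
  classical
  rw [diagMul, coeff_sum]
  simp only [coeff_monomial]
  rw [Finset.sum_ite_eq']
  split_ifs with h
  · rfl
  · simp [notMem_support_iff.mp h]

lemma diagMul_finsuppChoose (j : ℕ →₀ ℕ) (P : MvPolynomial ℕ ℚ) :
    diagMul (fun k => (finsuppChoose k j : ℚ)) P = monomial j 1 * hasse j P := by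
  ext k
  rw [coeff_diagMul, coeff_monomial_mul']
  split_ifs with h
  · rw [coeff_hasse, tsub_add_cancel_of_le h, one_mul]
  · rw [finsuppChoose_eq_zero h]; simp

lemma pow_linear_mem_span_finsuppChoose (n : ℕ) (w : ℕ → ℚ) (l : ℕ) :
    (fun k : ℕ →₀ ℕ => (∑ i ∈ range n, w i * k i) ^ l) ∈
      Submodule.span ℚ {g : (ℕ →₀ ℕ) → ℚ | ∃ Δ : ℕ →₀ ℕ, Δ.degree ≤ l ∧
        (∀ i, n ≤ i → Δ i = 0) ∧ g = fun k => (finsuppChoose k Δ : ℚ)} := by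
  induction l with
  | zero =>
    refine Submodule.subset_span ⟨0, by simp, by simp, ?_⟩
    ext k; simp
  | succ l ih =>
    set V := Submodule.span ℚ {g : (ℕ →₀ ℕ) → ℚ | ∃ Δ : ℕ →₀ ℕ, Δ.degree ≤ l + 1 ∧
        (∀ i, n ≤ i → Δ i = 0) ∧ g = fun k => (finsuppChoose k Δ : ℚ)} with hV
    have key : ∀ f ∈ Submodule.span ℚ {g : (ℕ →₀ ℕ) → ℚ | ∃ Δ : ℕ →₀ ℕ, Δ.degree ≤ l ∧
        (∀ i, n ≤ i → Δ i = 0) ∧ g = fun k => (finsuppChoose k Δ : ℚ)}, ∀ i < n,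
        (fun k : ℕ →₀ ℕ => (k i : ℚ) * f k) ∈ V := by
      intro f hf i hi
      induction hf using Submodule.span_induction with
      | mem f hf =>
        obtain ⟨Δ, h1, h2, rfl⟩ := hf
        have e : (fun k : ℕ →₀ ℕ => (k i : ℚ) * (finsuppChoose k Δ : ℚ)) =
            ((Δ i : ℚ) + 1) • (fun k => (finsuppChoose k (Δ + Finsupp.single i 1) : ℚ)) +
            (Δ i : ℚ) • (fun k => (finsuppChoose k Δ : ℚ)) := by
          ext k
          have := finsuppChoose_add_single_mul k Δ i
          by_cases h : Δ ≤ k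
          · have hle := Finsupp.le_def.mp h i
            have h3 := congrArg (Nat.cast (R := ℚ)) this
            rw [Nat.cast_mul, Nat.cast_mul, Nat.cast_sub hle] at h3
            push_cast at h3
            simp only [Pi.add_apply, Pi.smul_apply, smul_eq_mul]
            linear_combination -h3
          · have h' : ¬ Δ + Finsupp.single i 1 ≤ k := fun hh => h (le_self_add.trans hh)
            simp [finsuppChoose_eq_zero h, finsuppChoose_eq_zero h']
        rw [e]
        refine V.add_mem (V.smul_mem _ (Submodule.subset_span ⟨_, ?_, ?_, rfl⟩))
          (V.smul_mem _ (Submodule.subset_span ⟨_, ?_, ?_, rfl⟩))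
        · rw [map_add, Finsupp.degree_single]; omega
        · intro m hm
          have : i ≠ m := by omega
          simp [h2 m hm, this]
        · omega
        · exact h2
      | zero => simp only [Pi.zero_apply, mul_zero]; exact V.zero_mem
      | add x y _ _ hx hy =>
        have := V.add_mem hx hy
        convert this using 1
        ext k; simp [mul_add]
      | smul a x _ hx =>
        have := V.smul_mem a hx
        convert this using 1
        ext k; simp; ring
    have : (fun k : ℕ →₀ ℕ => (∑ i ∈ range n, w i * k i) ^ (l + 1)) =
        ∑ i ∈ range n, w i • fun k : ℕ →₀ ℕ => (k i : ℚ) * (∑ i ∈ range n, w i * k i) ^ l := by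
      ext k
      simp only [Finset.sum_apply, Pi.smul_apply, smul_eq_mul, pow_succ']
      rw [Finset.sum_mul]
      exact Finset.sum_congr rfl fun i _ => by ring
    rw [this]
    exact V.sum_mem fun i hi => V.smul_mem _ (key _ ih i (mem_range.mp hi))

lemma exists_injOn_sum_mul_pow (S : Finset (ℕ →₀ ℕ)) (n : ℕ) (hS : ∀ k ∈ S, ∀ i, n ≤ i → k i = 0) :
    ∃ B : ℕ, Set.InjOn (fun k : ℕ →₀ ℕ => ∑ i ∈ range n, k i * B ^ i) S := by
  classical
  set p : (ℕ →₀ ℕ) → Polynomial ℤ := fun k => ∑ i ∈ range n, Polynomial.monomial i (k i : ℤ)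
  have hp : ∀ k ∈ S, ∀ k' ∈ S, p k = p k' → k = k' := by
    intro k hk k' hk' h
    ext i
    by_cases hi : i < n
    · have := congrArg (fun q => Polynomial.coeff q i) h
      simpa [p, Polynomial.finsetSum_coeff, Polynomial.coeff_monomial, hi] using this
    · rw [hS k hk i (by omega), hS k' hk' i (by omega)]
  set Q : Polynomial ℤ := ∏ kk ∈ S.offDiag, (p kk.1 - p kk.2)
  have hQ : Q ≠ 0 := by
    refine Finset.prod_ne_zero_iff.mpr fun kk hkk => ?_
    rw [mem_offDiag] at hkk
    exact fun h => hkk.2.2 (hp _ hkk.1 _ hkk.2.1 (sub_eq_zero.mp h))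
  have : ∃ B : ℕ, Q.eval (B : ℤ) ≠ 0 := by
    by_contra! hcon
    apply hQ
    apply Polynomial.eq_zero_of_infinite_isRoot
    refine Set.Infinite.mono ?_ (Set.infinite_range_of_injective (Nat.cast_injective (R := ℤ)))
    rintro _ ⟨B, rfl⟩
    exact hcon B
  obtain ⟨B, hB⟩ := this
  refine ⟨B, fun k hk k' hk' h => ?_⟩
  by_contra hne
  rw [Polynomial.eval_prod, Finset.prod_ne_zero_iff] at hB
  refine hB (k, k') (by simp_all) ?_
  have h2 := congrArg (Nat.cast (R := ℤ)) h
  push_cast at h2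
  simp [p, Polynomial.eval_finsetSum, h2]

/-- Linearly independent polynomials have a nonvanishing generalized Wronskian. -/
lemma exists_det_hasse_ne_zero {s n : ℕ} (φ : Fin s → MvPolynomial ℕ ℚ)
    (hn : ∀ j, ∀ k ∈ (φ j).support, ∀ i, n ≤ i → k i = 0)
    (h : ∀ c : Fin s → ℚ, ∑ j, c j • φ j = 0 → c = 0) :
    ∃ Δ : Fin s → (ℕ →₀ ℕ), (∀ l, (Δ l).degree ≤ l) ∧ (∀ l, ∀ i, n ≤ i → Δ l i = 0) ∧
      (Matrix.of fun l j : Fin s => hasse (Δ l) (φ j)).det ≠ 0 := by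
  classical
  set S : Finset (ℕ →₀ ℕ) := univ.biUnion fun j => (φ j).support with hSdef
  have hS : ∀ k ∈ S, ∀ i, n ≤ i → k i = 0 := by
    intro k hk
    simp only [hSdef, mem_biUnion] at hk
    obtain ⟨j, _, hj⟩ := hk
    exact hn j k hj
  obtain ⟨B, hB⟩ := exists_injOn_sum_mul_pow S n hS
  set ω : (ℕ →₀ ℕ) → ℕ := fun k => ∑ i ∈ range n, k i * B ^ i with hω
  set κ : MvPolynomial ℕ ℚ →ₐ[ℚ] Polynomial ℚ := aeval fun i => Polynomial.X ^ (B ^ i) with hκ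
  have hκm : ∀ k ∈ S, ∀ a, κ (monomial k a) = Polynomial.monomial (ω k) a := by
    intro k hk a
    rw [hκ, aeval_monomial, Finsupp.prod_of_support_subset (s := range n)]
    · simp only [← pow_mul]
      rw [Finset.prod_pow_eq_pow_sum, ← Polynomial.C_mul_X_pow_eq_monomial]
      simp only [hω, mul_comm]
      rfl
    · intro i hi
      by_contra h
      rw [mem_range, not_lt] at h
      exact Finsupp.mem_support_iff.mp hi (hS k hk i h)
    · simp
  have hκS : ∀ P : MvPolynomial ℕ ℚ, P.support ⊆ S →
      κ P = ∑ k ∈ S, Polynomial.monomial (ω k) (coeff k P) := by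
    intro P hP
    have : P = ∑ k ∈ S, monomial k (coeff k P) := by
      conv_lhs => rw [P.as_sum]
      refine Finset.sum_subset hP fun k _ hk => ?_
      simp [notMem_support_iff.mp hk]
    conv_lhs => rw [this]
    rw [map_sum]
    exact Finset.sum_congr rfl fun k hk => hκm k hk _
  have hφS : ∀ j, (φ j).support ⊆ S := fun j => subset_biUnion_of_mem (fun j => (φ j).support)
    (mem_univ j)
  have hκinj : ∀ P : MvPolynomial ℕ ℚ, P.support ⊆ S → κ P = 0 → P = 0 := by
    intro P hP h0
    ext k
    by_cases hk : k ∈ S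
    · rw [hκS P hP] at h0
      have := congrArg (fun q => Polynomial.coeff q (ω k)) h0
      simp only [Polynomial.finsetSum_coeff, Polynomial.coeff_monomial,
        Polynomial.coeff_zero] at this
      rw [Finset.sum_eq_single k] at this
      · simpa using this
      · intro k' hk' hne
        rw [if_neg]
        exact fun hh => hne (hB hk' hk hh)
      · exact fun hh => absurd hk hh
    · rw [notMem_support_iff.mp fun hh => hk (hP hh), coeff_zero]
  have hdiagS : ∀ g j, (diagMul g (φ j)).support ⊆ S := by
    intro g j k hk
    apply hφS j
    rw [mem_support_iff, coeff_diagMul] at hk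
    exact mem_support_iff.mpr (right_ne_zero_of_mul hk)
  set v : Fin s → ((ℕ →₀ ℕ) → ℚ) := fun l k => (∑ i ∈ range n, (B : ℚ) ^ i * k i) ^ (l : ℕ)
  have hv : ∀ l k, v l k = (ω k : ℚ) ^ (l : ℕ) := by
    intro l k
    simp [v, hω, mul_comm]
  have hκd : ∀ l j, κ (diagMul (v l) (φ j)) = (euler ^ (l : ℕ)) (κ (φ j)) := by
    intro l j
    rw [hκS _ (hdiagS _ _), hκS _ (hφS j), map_sum]
    refine Finset.sum_congr rfl fun k _ => ?_
    ext m
    rw [coeff_euler_pow, coeff_diagMul, hv, Polynomial.coeff_monomial, Polynomial.coeff_monomial]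
    split_ifs with hm
    · rw [hm]
    · simp
  have hU := det_euler_ne_zero (fun j => κ (φ j)) (by
    intro c hc
    apply h c
    apply hκinj
    · intro k hk
      by_contra hkS
      apply mem_support_iff.mp hk
      rw [coeff_sum]
      refine Finset.sum_eq_zero fun j _ => ?_
      rw [coeff_smul, notMem_support_iff.mp fun hh => hkS (hφS j hh), smul_zero]
    · rw [map_sum, ← hc]
      exact Finset.sum_congr rfl fun j _ => map_smul _ _ _)
  set T : ((ℕ →₀ ℕ) → ℚ) →ₗ[ℚ] (Fin s → MvPolynomial ℕ ℚ) :=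
    { toFun := fun g j => diagMul g (φ j)
      map_add' := by
        intro g g'; ext j k; simp [coeff_diagMul, add_mul]
      map_smul' := by
        intro a g; ext j k; simp [coeff_diagMul, mul_assoc] }
  set f := ((Matrix.detRowAlternating (n := Fin s)
    (R := MvPolynomial ℕ ℚ)).toMultilinearMap.restrictScalars ℚ).compLinearMap fun _ => T
  have hfapp : ∀ g, f g = (Matrix.of fun l j => diagMul (g l) (φ j)).det := fun g => rfl
  have hfv : f v ≠ 0 := by
    intro h0
    apply hU
    have := congrArg κ h0
    rw [hfapp, AlgHom.map_det, map_zero] at this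
    rw [← this]
    congr 1
    ext1 l j
    simp [hκd]
  obtain ⟨g, hg, hfg⟩ := MultilinearMap.exists_ne_zero_of_mem_span f v _
    (fun l => pow_linear_mem_span_finsuppChoose n (fun i => (B : ℚ) ^ i) l) hfv
  choose Δ h1 h2 h3 using hg
  refine ⟨Δ, h1, h2, fun h0 => hfg ?_⟩
  have hM : (Matrix.of fun l j => diagMul (g l) (φ j)) = Matrix.of fun l j =>
      (fun l => (monomial (Δ l) 1 : MvPolynomial ℕ ℚ)) l *
        (Matrix.of fun l j : Fin s => hasse (Δ l) (φ j)) l j := by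
    ext1 l j
    simp only [Matrix.of_apply]
    rw [h3 l, diagMul_finsuppChoose]
  rw [hfapp, hM, Matrix.det_mul_column, h0, mul_zero]

end Wronskian

section Supported

lemma mem_supported_iff_coeff {R : Type*} [CommRing R] {S : Set ℕ} {P : MvPolynomial ℕ R} :
    P ∈ supported R S ↔ ∀ k, coeff k P ≠ 0 → ∀ i, k i ≠ 0 → i ∈ S := by
  rw [mem_supported]
  constructor
  · intro h k hk i hi
    exact h ((mem_vars_iff_mem_support i).mpr ⟨k, mem_support_iff.mpr hk,
      Finsupp.mem_support_iff.mpr hi⟩)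
  · intro h i hi
    obtain ⟨k, hk, hki⟩ := (mem_vars_iff_mem_support i).mp hi
    exact h k (mem_support_iff.mp hk) i (Finsupp.mem_support_iff.mp hki)

lemma hasse_mem_supported {R : Type*} [CommRing R] {S : Set ℕ} {P : MvPolynomial ℕ R}
    (h : P ∈ supported R S) (j : ℕ →₀ ℕ) : hasse j P ∈ supported R S := by
  rw [mem_supported_iff_coeff] at h ⊢
  intro k hk i hi
  rw [coeff_hasse] at hk
  exact h (k + j) (right_ne_zero_of_mul hk) i (by simp; omega)

lemma hasse_eq_zero_of_mem_supported {R : Type*} [CommRing R] {S : Set ℕ} {P : MvPolynomial ℕ R}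
    (h : P ∈ supported R S) {j : ℕ →₀ ℕ} {i : ℕ} (hi : i ∉ S) (hj : j i ≠ 0) : hasse j P = 0 := by
  rw [mem_supported_iff_coeff] at h
  ext k
  rw [coeff_hasse, coeff_zero]
  by_contra hk
  exact hi (h (k + j) (right_ne_zero_of_mul hk) i (by simp; omega))

lemma shift_mem_supported {S : Set ℕ} {P : MvPolynomial ℕ ℚ} (h : P ∈ supported ℚ S) (r : ℕ → ℚ) :
    shift r P ∈ supported ℚ S := by
  rw [mem_supported_iff_coeff]
  intro k hk i hi
  by_contra hS
  rw [coeff_shift, hasse_eq_zero_of_mem_supported h hS hi] at hk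
  simp at hk

lemma det_mem_supported {s : ℕ} {S : Set ℕ} (M : Matrix (Fin s) (Fin s) (MvPolynomial ℕ ℚ))
    (h : ∀ i j, M i j ∈ supported ℚ S) : M.det ∈ supported ℚ S := by
  rw [Matrix.det_apply]
  refine Subalgebra.sum_mem _ fun σ _ => ?_
  have := Subalgebra.prod_mem (supported ℚ S) (t := univ) fun i _ => h (σ i) i
  rcases Int.units_eq_one_or (Equiv.Perm.sign σ) with h | h
  · simpa [h] using this
  · simpa [h] using this

lemma coeff_add_mul_of_mem_supported {S T : Set ℕ} (hST : Disjoint S T) {G W : MvPolynomial ℕ ℚ}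
    (hG : G ∈ supported ℚ S) (hW : W ∈ supported ℚ T) {k l : ℕ →₀ ℕ}
    (hk : ∀ i, k i ≠ 0 → i ∈ S) (hl : ∀ i, l i ≠ 0 → i ∈ T) :
    coeff (k + l) (G * W) = coeff k G * coeff l W := by
  classical
  rw [mem_supported_iff_coeff] at hG hW
  rw [Set.disjoint_left] at hST
  rw [coeff_mul, Finset.sum_eq_single (k, l)]
  · rintro ⟨k', l'⟩ hkl hne
    by_contra hcon
    have h1 := hG k' (left_ne_zero_of_mul hcon)
    have h2 := hW l' (right_ne_zero_of_mul hcon)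
    rw [Finset.HasAntidiagonal.mem_antidiagonal] at hkl
    apply hne
    have key : ∀ i, k' i = k i ∧ l' i = l i := by
      intro i
      have e : k' i + l' i = k i + l i := by
        have := DFunLike.congr_fun hkl i
        simpa using this
      by_cases hiS : i ∈ S
      · have hiT := hST hiS
        have a1 : l i = 0 := by by_contra hh; exact hiT (hl i hh)
        have a2 : l' i = 0 := by by_contra hh; exact hiT (h2 i hh)
        omega
      · have a1 : k i = 0 := by by_contra hh; exact hiS (hk i hh)
        have a2 : k' i = 0 := by by_contra hh; exact hiS (h1 i hh)
        omega
    ext i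
    · exact (key i).1
    · exact (key i).2
  · intro hh
    simp [Finset.HasAntidiagonal.mem_antidiagonal] at hh

lemma hasse_mul_of_mem_supported {S : Set ℕ} {P : MvPolynomial ℕ ℚ} (hP : P ∈ supported ℚ S)
    {j : ℕ →₀ ℕ} (hj : ∀ i ∈ S, j i = 0) (Q : MvPolynomial ℕ ℚ) :
    hasse j (P * Q) = P * hasse j Q := by
  refine hasse_mul_of_pderiv_eq_zero (fun i hi => ?_) Q
  refine pderiv_eq_zero_of_notMem_vars fun hv => ?_
  rw [mem_supported] at hP
  exact Finsupp.mem_support_iff.mp hi (hj i (hP hv))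

/-- The part of `P` whose exponents exceed `k₀` by an exponent supported in `S`, divided by
the monomial of exponent `k₀`. -/
noncomputable def polySlice (S : Set ℕ) (k₀ : ℕ →₀ ℕ) (P : MvPolynomial ℕ ℤ) : MvPolynomial ℕ ℤ := by
  classical
  exact ∑ k ∈ P.support, monomial (k - k₀)
    (if k₀ ≤ k ∧ ∀ i, (k - k₀) i ≠ 0 → i ∈ S then coeff k P else 0)

lemma coeff_polySlice {S : Set ℕ} {k₀ k : ℕ →₀ ℕ} {P : MvPolynomial ℕ ℤ} (hk : ∀ i, k i ≠ 0 → i ∈ S) :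
    coeff k (polySlice S k₀ P) = coeff (k + k₀) P := by
  classical
  rw [polySlice, coeff_sum]
  simp only [coeff_monomial]
  rw [Finset.sum_eq_single (k + k₀)]
  · have : k₀ ≤ k + k₀ ∧ ∀ i, (k + k₀ - k₀) i ≠ 0 → i ∈ S := by
      rw [add_tsub_cancel_right]
      exact ⟨le_add_self, hk⟩
    rw [if_pos (add_tsub_cancel_right _ _), if_pos this]
  · intro l _ hne
    split_ifs with h1 h2
    · exact absurd (by rw [← h1, tsub_add_cancel_of_le h2.1]) hne
    · rfl
    · rfl
  · intro hh
    simp [notMem_support_iff.mp hh]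

lemma polySlice_mem_supported (S : Set ℕ) (k₀ : ℕ →₀ ℕ) (P : MvPolynomial ℕ ℤ) :
    polySlice S k₀ P ∈ supported ℤ S := by
  classical
  rw [polySlice]
  refine Subalgebra.sum_mem _ fun k _ => ?_
  rw [mem_supported_iff_coeff]
  intro l hl i hi
  rw [coeff_monomial] at hl
  split_ifs at hl with h1 h2
  · exact h2.2 i (by rwa [h1])
  · simp at hl
  · simp at hl

lemma lOne_polySlice_le (S : Set ℕ) (k₀ : ℕ →₀ ℕ) (P : MvPolynomial ℕ ℤ) :
    lOne (polySlice S k₀ P) ≤ lOne P := by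
  classical
  rw [polySlice]
  refine (lOne_sum_le _ _).trans (Finset.sum_le_sum fun k _ => ?_)
  have := lOne_monomial_mul_le (k - k₀)
    (if k₀ ≤ k ∧ ∀ i, (k - k₀) i ≠ 0 → i ∈ S then coeff k P else 0) 1
  rw [mul_one, lOne_one, mul_one] at this
  refine this.trans ?_
  split_ifs <;> simp

end Supported

section Weight

/-- The weight `∑ i < n, j i / d i` of a multi-index. -/
noncomputable def weight (n : ℕ) (d : ℕ → ℕ) (j : ℕ →₀ ℕ) : ℝ := ∑ i ∈ range n, (j i : ℝ) / d i

lemma weight_add (n : ℕ) (d : ℕ → ℕ) (j k : ℕ →₀ ℕ) :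
    weight n d (j + k) = weight n d j + weight n d k := by
  simp [weight, add_div, sum_add_distrib]

lemma weight_nonneg (n : ℕ) (d : ℕ → ℕ) (j : ℕ →₀ ℕ) : 0 ≤ weight n d j :=
  Finset.sum_nonneg fun _ _ => by positivity

lemma weight_zero (n : ℕ) (d : ℕ → ℕ) : weight n d 0 = 0 := by simp [weight]

/-- All exponents of `P` have weight at least `c`. -/
def OrdGe (n : ℕ) (d : ℕ → ℕ) (P : MvPolynomial ℕ ℚ) (c : ℝ) : Prop :=
  ∀ j, coeff j P ≠ 0 → c ≤ weight n d j

variable {n : ℕ} {d : ℕ → ℕ}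

lemma OrdGe.zero_right (P : MvPolynomial ℕ ℚ) : OrdGe n d P 0 := fun _ _ => weight_nonneg _ _ _

lemma OrdGe.sup {P : MvPolynomial ℕ ℚ} {c c' : ℝ} (h : OrdGe n d P c) (h' : OrdGe n d P c') :
    OrdGe n d P (max c c') := fun j hj => max_le (h j hj) (h' j hj)

lemma OrdGe.mul {P Q : MvPolynomial ℕ ℚ} {c c' : ℝ} (h : OrdGe n d P c) (h' : OrdGe n d Q c') :
    OrdGe n d (P * Q) (c + c') := by
  classical
  intro j hj
  rw [coeff_mul] at hj
  obtain ⟨x, hx, hne⟩ := Finset.exists_ne_zero_of_sum_ne_zero hj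
  rw [← Finset.HasAntidiagonal.mem_antidiagonal.mp hx, weight_add]
  exact add_le_add (h _ (left_ne_zero_of_mul hne)) (h' _ (right_ne_zero_of_mul hne))

lemma OrdGe.sum {ι : Type*} (s : Finset ι) (f : ι → MvPolynomial ℕ ℚ) {c : ℝ}
    (h : ∀ i ∈ s, OrdGe n d (f i) c) : OrdGe n d (∑ i ∈ s, f i) c := by
  intro j hj
  rw [coeff_sum] at hj
  obtain ⟨i, hi, hne⟩ := Finset.exists_ne_zero_of_sum_ne_zero hj
  exact h i hi j hne

lemma OrdGe.prod {ι : Type*} (s : Finset ι) (f : ι → MvPolynomial ℕ ℚ) (c : ι → ℝ)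
    (h : ∀ i ∈ s, OrdGe n d (f i) (c i)) : OrdGe n d (∏ i ∈ s, f i) (∑ i ∈ s, c i) := by
  classical
  induction s using Finset.induction_on with
  | empty => simpa using OrdGe.zero_right _
  | insert i s hi ih =>
    rw [prod_insert hi, sum_insert hi]
    exact (h i (mem_insert_self _ _)).mul (ih fun l hl => h l (mem_insert_of_mem hl))

lemma OrdGe.det {s : ℕ} (M : Matrix (Fin s) (Fin s) (MvPolynomial ℕ ℚ)) (c : Fin s → ℝ)
    (h : ∀ a b, OrdGe n d (M a b) (c b)) : OrdGe n d M.det (∑ b, c b) := by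
  rw [Matrix.det_apply]
  refine OrdGe.sum _ _ fun σ _ => ?_
  have := OrdGe.prod (n := n) (d := d) univ (fun i => M (σ i) i) c fun i _ => h (σ i) i
  rcases Int.units_eq_one_or (Equiv.Perm.sign σ) with h | h
  · simpa [h] using this
  · intro j hj
    refine this j fun h0 => hj ?_
    simp [h, h0]

lemma OrdGe.hasse {P : MvPolynomial ℕ ℚ} {c : ℝ} (h : OrdGe n d P c) (j : ℕ →₀ ℕ) :
    OrdGe n d (hasse j P) (c - weight n d j) := by
  intro k hk
  rw [coeff_hasse] at hk
  have := h _ (right_ne_zero_of_mul hk)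
  rw [weight_add] at this
  linarith

end Weight

section Univariate

lemma den_pow_rootMultiplicity_dvd_leadingCoeff (z : Polynomial ℤ) (r : ℚ) :
    (r.den : ℤ) ^ ((z.map (Int.castRingHom ℚ)).rootMultiplicity r) ∣ z.leadingCoeff := by
  set t := (z.map (Int.castRingHom ℚ)).rootMultiplicity r
  set b : Polynomial ℤ := Polynomial.C (r.den : ℤ) * Polynomial.X + Polynomial.C (-r.num)
  have hden : (r.den : ℤ) ≠ 0 := by exact_mod_cast r.den_nz
  have hb : b.IsPrimitive := by
    intro c hc
    rw [Polynomial.C_dvd_iff_dvd_coeff] at hc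
    have h0 := hc 0
    have h1 := hc 1
    simp only [b, Polynomial.coeff_add, Polynomial.coeff_C_mul, Polynomial.coeff_X,
      Polynomial.coeff_C] at h0 h1
    simp at h0 h1
    have hcop : IsCoprime r.num (r.den : ℤ) := r.isCoprime_num_den
    exact hcop.isUnit_of_dvd' h0 h1
  have hbt : ∀ t, (b ^ t).IsPrimitive := by
    intro t
    induction t with
    | zero => simp
    | succ t ih => rw [pow_succ]; exact ih.mul hb
  have hmap : b.map (Int.castRingHom ℚ) =
      Polynomial.C (r.den : ℚ) * (Polynomial.X - Polynomial.C r) := by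
    have : (r.num : ℚ) = r.den * r := (Rat.den_mul_eq_num r).symm
    simp only [b, Polynomial.map_add, Polynomial.map_mul, Polynomial.map_C, Polynomial.map_X]
    rw [mul_sub, ← Polynomial.C_mul, ← this]
    simp [sub_eq_add_neg]
  have hdvd : b ^ t ∣ z := by
    rw [Polynomial.IsPrimitive.Int.dvd_iff_map_cast_dvd_map_cast _ _ (hbt t), Polynomial.map_pow,
      hmap, mul_pow, ← Polynomial.C_pow]
    have hu : IsUnit (Polynomial.C ((r.den : ℚ) ^ t)) := by
      rw [Polynomial.isUnit_C]
      exact (pow_ne_zero _ (by exact_mod_cast r.den_nz)).isUnit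
    rw [hu.mul_left_dvd]
    exact Polynomial.pow_rootMultiplicity_dvd _ _
  have := Polynomial.leadingCoeff_dvd_leadingCoeff hdvd
  rwa [Polynomial.leadingCoeff_pow, show b.leadingCoeff = r.den from
    Polynomial.leadingCoeff_linear hden] at this

end Univariate

section Univariate

lemma coeff_single_aeval_X (n e : ℕ) (w : Polynomial ℚ) :
    coeff (Finsupp.single n e) (Polynomial.aeval (X n : MvPolynomial ℕ ℚ) w) = w.coeff e := by
  classical
  induction w using Polynomial.induction_on' with
  | add p q hp hq => simp [hp, hq]
  | monomial m a =>
    rw [Polynomial.aeval_monomial, Polynomial.coeff_monomial, algebraMap_eq, coeff_C_mul,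
      coeff_X_pow, mul_ite, mul_one, mul_zero]
    by_cases h : m = e
    · simp [h]
    · rw [if_neg h, if_neg]
      intro hh
      have := DFunLike.congr_fun hh n
      simp only [Finsupp.single_eq_same] at this
      exact h this

lemma exists_aeval_X_eq {n : ℕ} {W : MvPolynomial ℕ ℚ} (hW : W ∈ supported ℚ {n}) :
    ∃ w : Polynomial ℚ, Polynomial.aeval (X n : MvPolynomial ℕ ℚ) w = W := by
  rw [supported_eq_adjoin_X, Set.image_singleton, Algebra.adjoin_singleton_eq_range_aeval] at hW
  exact hW

lemma shift_aeval_X (r : ℕ → ℚ) (n : ℕ) (w : Polynomial ℚ) :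
    shift r (Polynomial.aeval (X n : MvPolynomial ℕ ℚ) w) =
      Polynomial.aeval (X n : MvPolynomial ℕ ℚ) (w.comp (Polynomial.X + Polynomial.C (r n))) := by
  rw [← Polynomial.aeval_algHom_apply, Polynomial.aeval_comp]
  simp [shift]

/-- The order of vanishing at a rational point of a univariate factor of an integral polynomial is
controlled by the size of the latter. -/
lemma exists_coeff_single_shift_ne_zero {S : Set ℕ} {n : ℕ} (hnS : n ∉ S) {F : MvPolynomial ℕ ℤ}
    {G W : MvPolynomial ℕ ℚ} (hG : G ∈ supported ℚ S) (hW : W ∈ supported ℚ {n}) (hG0 : G ≠ 0)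
    (hW0 : W ≠ 0) (hF : map (Int.castRingHom ℚ) F = G * W) (r : ℕ → ℚ) :
    ∃ t, coeff (Finsupp.single n t) (shift r W) ≠ 0 ∧ ((r n).den : ℤ) ^ t ≤ lOne F := by
  obtain ⟨k, hk⟩ := MvPolynomial.ne_zero_iff.mp hG0
  have hkS := mem_supported_iff_coeff.mp hG k hk
  have hST : Disjoint S {n} := Set.disjoint_singleton_right.mpr hnS
  obtain ⟨w, rfl⟩ := exists_aeval_X_eq hW
  have hw0 : w ≠ 0 := by rintro rfl; simp at hW0
  set c := coeff k G
  have hcoeff : ∀ e, c * w.coeff e = (coeff (k + Finsupp.single n e) F : ℤ) := by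
    intro e
    have h1 : coeff (k + Finsupp.single n e) (map (Int.castRingHom ℚ) F) =
        c * coeff (Finsupp.single n e) (Polynomial.aeval (X n : MvPolynomial ℕ ℚ) w) := by
      rw [hF]
      refine coeff_add_mul_of_mem_supported hST hG hW hkS fun i hi => ?_
      by_contra hne
      have : n ≠ i := fun h => hne h.symm
      simp [this] at hi
    rw [coeff_single_aeval_X, coeff_map] at h1
    rw [← h1]; rfl
  obtain ⟨z, hz⟩ : ∃ z : Polynomial ℤ, z.map (Int.castRingHom ℚ) = Polynomial.C c * w := by
    rw [← Polynomial.mem_lifts, Polynomial.lifts_iff_coeff_lifts]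
    intro e
    exact ⟨coeff (k + Finsupp.single n e) F, by rw [Polynomial.coeff_C_mul, hcoeff]; rfl⟩
  have hz0 : z ≠ 0 := by
    rintro rfl
    rw [Polynomial.map_zero, eq_comm, mul_eq_zero] at hz
    rcases hz with hz | hz
    · exact hk (Polynomial.C_eq_zero.mp hz)
    · exact hw0 hz
  have hzc : ∀ e, z.coeff e = coeff (k + Finsupp.single n e) F := by
    intro e
    have h1 := congrArg (fun q => Polynomial.coeff q e) hz
    simp only [Polynomial.coeff_map, Polynomial.coeff_C_mul, hcoeff] at h1
    exact Int.cast_injective (α := ℚ) h1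
  have hmul : (z.map (Int.castRingHom ℚ)).rootMultiplicity (r n) = w.rootMultiplicity (r n) := by
    rw [hz, Polynomial.rootMultiplicity_mul, Polynomial.rootMultiplicity_C, zero_add]
    exact mul_ne_zero (Polynomial.C_ne_zero.mpr hk) hw0
  refine ⟨w.rootMultiplicity (r n), ?_, ?_⟩
  · rw [shift_aeval_X, coeff_single_aeval_X, Polynomial.rootMultiplicity_eq_natTrailingDegree]
    have : w.comp (Polynomial.X + Polynomial.C (r n)) ≠ 0 := by
      rw [← Polynomial.taylor_apply]
      simpa using hw0
    exact Polynomial.trailingCoeff_nonzero_iff_nonzero.mpr this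
  · have h1 := den_pow_rootMultiplicity_dvd_leadingCoeff z (r n)
    rw [hmul] at h1
    have h2 := Int.le_of_dvd (abs_pos.mpr (Polynomial.leadingCoeff_ne_zero.mpr hz0))
      ((dvd_abs _ _).mpr h1)
    refine h2.trans ?_
    rw [Polynomial.leadingCoeff, hzc]
    exact abs_coeff_le_lOne _ _

end Univariate

section Minimal

lemma eq_zero_of_sum_smul_eq_zero_of_minimal {A : Type*} [CommRing A] [Algebra ℚ A]
    (U V : Subalgebra ℚ A) {s : ℕ} (φ ψ : Fin s → A) (hφ : ∀ j, φ j ∈ U) (hψ : ∀ j, ψ j ∈ V)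
    (hmin : ∀ t < s, ∀ φ' ψ' : Fin t → A, (∀ j, φ' j ∈ U) → (∀ j, ψ' j ∈ V) →
      ∑ j, φ' j * ψ' j ≠ ∑ j, φ j * ψ j) (c : Fin s → ℚ) (hc : ∑ j, c j • φ j = 0) : c = 0 := by
  by_contra hne
  obtain ⟨j₀, hj₀⟩ := Function.ne_iff.mp hne
  simp only [Pi.zero_apply] at hj₀
  cases s with
  | zero => exact j₀.elim0
  | succ t =>
    refine hmin t (Nat.lt_succ_self t) (fun i => φ (j₀.succAbove i))
      (fun i => ψ (j₀.succAbove i) - (c (j₀.succAbove i) / c j₀) • ψ j₀) (fun i => hφ _)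
      (fun i => V.sub_mem (hψ _) (V.smul_mem (hψ _) _)) ?_
    rw [Fin.sum_univ_succAbove _ j₀] at hc ⊢
    have h1 : φ j₀ = -∑ i, (c (j₀.succAbove i) / c j₀) • φ (j₀.succAbove i) := by
      have h2 := congrArg (fun x => (c j₀)⁻¹ • x) hc
      simp only [smul_add, smul_smul, inv_mul_cancel₀ hj₀, one_smul, smul_zero, Finset.smul_sum]
        at h2
      rw [eq_neg_iff_add_eq_zero, ← h2]
      congr 1
      exact Finset.sum_congr rfl fun i _ => by rw [div_eq_inv_mul]
    rw [h1, neg_mul, Finset.sum_mul, ← sub_eq_neg_add, ← sum_sub_distrib]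
    refine Finset.sum_congr rfl fun i _ => ?_
    rw [mul_sub, smul_mul_assoc, mul_smul_comm]

end Minimal

/-- All exponents of `P` lie in the box `[0, d]` and involve the first `n` variables only. -/
def BoxSupported (n : ℕ) (d : ℕ → ℕ) (P : MvPolynomial ℕ ℤ) : Prop :=
  ∀ k ∈ P.support, (∀ i, n ≤ i → k i = 0) ∧ ∀ i, k i ≤ d i

lemma BoxSupported.hasse {n : ℕ} {d : ℕ → ℕ} {P : MvPolynomial ℕ ℤ} (h : BoxSupported n d P)
    (j : ℕ →₀ ℕ) : BoxSupported n d (hasse j P) := by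
  intro k hk
  rw [mem_support_iff, coeff_hasse] at hk
  obtain ⟨h1, h2⟩ := h _ (mem_support_iff.mpr (right_ne_zero_of_mul hk))
  refine ⟨fun i hi => ?_, fun i => ?_⟩
  · have := h1 i hi
    simp at this; exact this.1
  · have := h2 i
    simp at this; omega

lemma BoxSupported.prod {ι : Type*} {n : ℕ} {d : ℕ → ℕ} (s : Finset ι)
    (f : ι → MvPolynomial ℕ ℤ) (h : ∀ i ∈ s, BoxSupported n d (f i)) :
    BoxSupported n (fun i => #s * d i) (∏ i ∈ s, f i) := by
  classical
  induction s using Finset.induction_on with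
  | empty =>
    intro k hk
    rw [prod_empty, mem_support_iff, coeff_one] at hk
    have : k = 0 := by by_contra hne; exact hk (if_neg fun h => hne h.symm)
    simp [this]
  | insert i s hi ih =>
    intro k hk
    rw [prod_insert hi, mem_support_iff, coeff_mul] at hk
    obtain ⟨x, hx, hne⟩ := Finset.exists_ne_zero_of_sum_ne_zero hk
    rw [Finset.HasAntidiagonal.mem_antidiagonal] at hx
    obtain ⟨h1, h2⟩ := h i (mem_insert_self _ _) x.1
      (mem_support_iff.mpr (left_ne_zero_of_mul hne))
    obtain ⟨h3, h4⟩ := ih (fun l hl => h l (mem_insert_of_mem hl)) x.2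
      (mem_support_iff.mpr (right_ne_zero_of_mul hne))
    rw [← hx, card_insert_of_notMem hi]
    refine ⟨fun l hl => ?_, fun l => ?_⟩
    · simp [h1 l hl, h3 l hl]
    · have := h2 l
      have := h4 l
      simp only [Finsupp.add_apply, add_mul, one_mul] at *
      omega

lemma BoxSupported.det {s n : ℕ} {d : ℕ → ℕ} (M : Matrix (Fin s) (Fin s) (MvPolynomial ℕ ℤ))
    (h : ∀ i j, BoxSupported n d (M i j)) : BoxSupported n (fun i => s * d i) M.det := by
  intro k hk
  rw [mem_support_iff, Matrix.det_apply, coeff_sum] at hk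
  obtain ⟨σ, _, hne⟩ := Finset.exists_ne_zero_of_sum_ne_zero hk
  have := BoxSupported.prod univ (fun i => M (σ i) i) fun i _ => h (σ i) i
  rw [card_univ, Fintype.card_fin] at this
  refine this k (mem_support_iff.mpr fun h0 => hne ?_)
  rcases Int.units_eq_one_or (Equiv.Perm.sign σ) with h | h <;> simp [h, h0]

/-- Splitting off the last variable. -/
lemma BoxSupported.exists_sum_mul {n : ℕ} {d : ℕ → ℕ} {P : MvPolynomial ℕ ℤ}
    (h : BoxSupported (n + 1) d P) : ∃ φ ψ : Fin (d n + 1) → MvPolynomial ℕ ℚ,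
      (∀ j, φ j ∈ supported ℚ (Set.Iio n)) ∧ (∀ j, ψ j ∈ supported ℚ {n}) ∧
      ∑ j, φ j * ψ j = map (Int.castRingHom ℚ) P := by
  classical
  refine ⟨fun b => map (Int.castRingHom ℚ) (polySlice (Set.Iio n) (Finsupp.single n b) P),
    fun b => monomial (Finsupp.single n b) 1, fun b => ?_, fun b => ?_, ?_⟩
  · rw [mem_supported_iff_coeff]
    intro k hk
    rw [coeff_map] at hk
    have h1 := mem_supported_iff_coeff.mp
      (polySlice_mem_supported (Set.Iio n) (Finsupp.single n (b : ℕ)) P) k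
    exact h1 fun h0 => hk (by rw [h0, map_zero])
  · rw [mem_supported_iff_coeff]
    intro k hk i hi
    rw [coeff_monomial] at hk
    split_ifs at hk with hh
    · rw [← hh] at hi
      by_contra hne
      have : n ≠ i := fun h => hne h.symm
      simp [this] at hi
    · simp at hk
  · have hmap : ∀ b : ℕ, (monomial (Finsupp.single n b) 1 : MvPolynomial ℕ ℚ) =
        map (Int.castRingHom ℚ) (monomial (Finsupp.single n b) 1) := by
      intro b; simp [map_monomial]
    simp only [hmap, ← map_mul, ← map_sum]
    congr 1
    ext k
    rw [coeff_sum]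
    simp only [coeff_mul_monomial', mul_one]
    have hslice : ∀ e : ℕ →₀ ℕ, ∀ b : ℕ, (∃ i, e i ≠ 0 ∧ ¬ i < n) →
        coeff e (polySlice (Set.Iio n) (Finsupp.single n b) P) = 0 := by
      rintro e b ⟨i, hi, hin⟩
      by_contra hne
      exact hin (mem_supported_iff_coeff.mp (polySlice_mem_supported _ _ _) e hne i hi)
    by_cases hk : (∀ i, n + 1 ≤ i → k i = 0) ∧ k n ≤ d n
    · rw [Finset.sum_eq_single (⟨k n, by omega⟩ : Fin (d n + 1))]
      · simp only
        have hle : Finsupp.single n (k n) ≤ k := by simp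
        rw [if_pos hle, coeff_polySlice, tsub_add_cancel_of_le hle]
        intro i hi
        by_contra hin
        apply hi
        simp only [Set.mem_Iio, not_lt] at hin
        rcases Nat.lt_or_ge n i with h1 | h1
        · have : n ≠ i := by omega
          simp [hk.1 i h1]
        · have : i = n := by omega
          subst this; simp
      · intro b _ hb
        split_ifs with hle
        · refine hslice _ _ ⟨n, ?_, lt_irrefl n⟩
          simp only [Finsupp.tsub_apply, Finsupp.single_eq_same]
          have h1 := Finsupp.le_def.mp hle n
          simp only [Finsupp.single_eq_same] at h1
          have h2 : (b : ℕ) ≠ k n := fun h => hb (Fin.ext h)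
          omega
        · rfl
      · simp
    · have hkP : coeff k P = 0 := by
        by_contra hne
        obtain ⟨h1, h2⟩ := h k (mem_support_iff.mpr hne)
        exact hk ⟨h1, h2 n⟩
      rw [hkP]
      refine Finset.sum_eq_zero fun b _ => ?_
      split_ifs with hle
      · by_cases hk1 : ∀ i, n + 1 ≤ i → k i = 0
        · refine hslice _ _ ⟨n, ?_, lt_irrefl n⟩
          have : ¬ k n ≤ d n := fun hh => hk ⟨hk1, hh⟩
          simp only [Finsupp.tsub_apply, Finsupp.single_eq_same]
          omega
        · push Not at hk1
          obtain ⟨i, hi, hki⟩ := hk1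
          refine hslice _ _ ⟨i, ?_, by omega⟩
          have : n ≠ i := by omega
          simpa [this] using hki
      · rfl

section RothLemma

lemma exists_wronskian_factorization {n : ℕ} {d : ℕ → ℕ} {P : MvPolynomial ℕ ℤ} (hP0 : P ≠ 0)
    (hP : BoxSupported (n + 1) d P) :
    ∃ s : ℕ, 1 ≤ s ∧ s ≤ d n + 1 ∧ ∃ Δ Λ : Fin s → (ℕ →₀ ℕ),
      (∀ l, (Δ l).degree ≤ l) ∧ (∀ l, ∀ i, n ≤ i → Δ l i = 0) ∧
      (∀ l, (Λ l) n ≤ l) ∧ (∀ l, ∀ i, i ≠ n → Λ l i = 0) ∧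
      ∃ G W : MvPolynomial ℕ ℚ, G ∈ supported ℚ (Set.Iio n) ∧ W ∈ supported ℚ {n} ∧
        G ≠ 0 ∧ W ≠ 0 ∧
        map (Int.castRingHom ℚ) (Matrix.of fun a b => hasse (Δ a) (hasse (Λ b) P)).det = G * W := by
  classical
  have hex : ∃ s : ℕ, ∃ φ ψ : Fin s → MvPolynomial ℕ ℚ,
      (∀ j, φ j ∈ supported ℚ (Set.Iio n)) ∧ (∀ j, ψ j ∈ supported ℚ {n}) ∧
      ∑ j, φ j * ψ j = map (Int.castRingHom ℚ) P := ⟨_, hP.exists_sum_mul⟩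
  have hle : Nat.find hex ≤ d n + 1 := Nat.find_min' hex hP.exists_sum_mul
  obtain ⟨φ, ψ, hφ, hψ, hsum⟩ := Nat.find_spec hex
  have hmin : ∀ t < Nat.find hex, ∀ φ' ψ' : Fin t → MvPolynomial ℕ ℚ,
      (∀ j, φ' j ∈ supported ℚ (Set.Iio n)) → (∀ j, ψ' j ∈ supported ℚ {n}) →
      ∑ j, φ' j * ψ' j ≠ ∑ j, φ j * ψ j := by
    intro t ht φ' ψ' h1 h2 h3
    exact Nat.find_min hex ht ⟨φ', ψ', h1, h2, h3.trans hsum⟩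
  generalize Nat.find hex = s at *
  have hs : 1 ≤ s := by
    by_contra h
    have : s = 0 := by omega
    subst this
    rw [univ_eq_empty, sum_empty, eq_comm] at hsum
    exact hP0 (map_injective _ (Int.castRingHom ℚ).injective_int (by rw [hsum, map_zero]))
  have hφi := eq_zero_of_sum_smul_eq_zero_of_minimal (supported ℚ (Set.Iio n))
    (supported ℚ {n}) φ ψ hφ hψ hmin
  have hψi := eq_zero_of_sum_smul_eq_zero_of_minimal (supported ℚ {n})
    (supported ℚ (Set.Iio n)) ψ φ hψ hφ (fun t ht φ' ψ' h1 h2 h3 =>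
      hmin t ht ψ' φ' h2 h1 (by simpa only [mul_comm] using h3))
  obtain ⟨Δ, hΔ1, hΔ2, hΔ3⟩ := exists_det_hasse_ne_zero (n := n) φ (by
    intro j k hk i hi
    by_contra hne
    have := mem_supported_iff_coeff.mp (hφ j) k (mem_support_iff.mp hk) i hne
    simp at this; omega) hφi
  obtain ⟨Λ, hΛ1, -, hΛ3⟩ := exists_det_hasse_ne_zero (n := n + 1) ψ (by
    intro j k hk i hi
    by_contra hne
    have := mem_supported_iff_coeff.mp (hψ j) k (mem_support_iff.mp hk) i hne
    simp at this; omega) hψi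
  have hΛ4 : ∀ l, ∀ i, i ≠ n → Λ l i = 0 := by
    intro l i hi
    by_contra hne
    apply hΛ3
    refine Matrix.det_eq_zero_of_row_eq_zero l fun j => ?_
    rw [Matrix.of_apply]
    exact hasse_eq_zero_of_mem_supported (hψ j) (i := i) (by simpa using hi) hne
  refine ⟨s, hs, hle, Δ, Λ, hΔ1, hΔ2, fun l => (Finsupp.le_degree _ _).trans (hΛ1 l), hΛ4,
    _, _, ?_, ?_, hΔ3, hΛ3, ?_⟩
  · exact det_mem_supported _ fun i j => hasse_mem_supported (hφ j) _
  · exact det_mem_supported _ fun i j => hasse_mem_supported (hψ j) _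
  · rw [RingHom.map_det, ← Matrix.det_transpose (Matrix.of fun l j => hasse (Λ l) (ψ j)),
      ← Matrix.det_mul]
    congr 1
    ext1 a b
    rw [RingHom.mapMatrix_apply, Matrix.map_apply, Matrix.of_apply, Matrix.mul_apply,
      ← hasse_map, ← hasse_map, ← hsum, hasse_sum, hasse_sum]
    refine Finset.sum_congr rfl fun j _ => ?_
    rw [Matrix.transpose_apply, Matrix.of_apply, Matrix.of_apply,
      hasse_mul_of_mem_supported (hφ j) (fun i hi => hΛ4 b i (by simp at hi; omega)),
      mul_comm (φ j), hasse_mul_of_mem_supported (hasse_mem_supported (hψ j) _)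
        (fun i hi => hΔ2 a i (by simp at hi; omega)), mul_comm]

lemma log_lOne_det_hasse_le {n s : ℕ} {d : ℕ → ℕ} {P : MvPolynomial ℕ ℤ} (hP0 : P ≠ 0)
    (hP : BoxSupported (n + 1) d P) (hs : 1 ≤ s) (hsd : s ≤ d n + 1) (Δ Λ : Fin s → (ℕ →₀ ℕ))
    (hF : (Matrix.of fun a b => hasse (Δ a) (hasse (Λ b) P)).det ≠ 0) :
    Real.log (lOne (Matrix.of fun a b => hasse (Δ a) (hasse (Λ b) P)).det : ℤ) ≤
      s * (d n + 2 * ∑ i ∈ range (n + 1), (d i : ℝ) + Real.log (lOne P : ℤ)) := by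
  set F := (Matrix.of fun a b => hasse (Δ a) (hasse (Λ b) P)).det
  set D := ∑ i ∈ range (n + 1), d i
  have h1 : lOne F ≤ s.factorial * (2 ^ D * (2 ^ D * lOne P)) ^ s := by
    refine lOne_det_le _ fun a b => ?_
    rw [Matrix.of_apply]
    refine (lOne_hasse_le (Δ a) (hP.hasse (Λ b))).trans ?_
    exact mul_le_mul_of_nonneg_left (lOne_hasse_le (Λ b) hP) (by positivity)
  have hFpos : (0 : ℝ) < (lOne F : ℤ) := by exact_mod_cast lOne_pos hF
  have hPpos : (0 : ℝ) < (lOne P : ℤ) := by exact_mod_cast lOne_pos hP0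
  have hs0 : (0 : ℝ) < s := by exact_mod_cast hs
  have h2 : ((lOne F : ℤ) : ℝ) ≤ (s : ℝ) ^ s * (2 ^ D * (2 ^ D * (lOne P : ℤ))) ^ s := by
    have h3 : ((lOne F : ℤ) : ℝ) ≤ s.factorial * (2 ^ D * (2 ^ D * (lOne P : ℤ))) ^ s := by
      exact_mod_cast h1
    refine h3.trans (mul_le_mul_of_nonneg_right ?_ (by positivity))
    exact_mod_cast Nat.factorial_le_pow s
  have h3 := Real.log_le_log hFpos h2
  rw [← mul_pow, Real.log_pow, Real.log_mul (by positivity) (by positivity),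
    Real.log_mul (by positivity) (by positivity), Real.log_mul (by positivity) (by positivity),
    Real.log_pow] at h3
  refine h3.trans (mul_le_mul_of_nonneg_left ?_ hs0.le)
  have h4 := Real.log_le_sub_one_of_pos hs0
  have h5 : (s : ℝ) ≤ d n + 1 := by exact_mod_cast hsd
  have h6 : Real.log 2 ≤ 1 := by
    have := Real.log_le_sub_one_of_pos (show (0 : ℝ) < 2 by norm_num)
    linarith
  have h7 : (D : ℝ) * Real.log 2 ≤ D := by
    have : (0 : ℝ) ≤ D := by positivity
    nlinarith
  have h8 : (D : ℝ) = ∑ i ∈ range (n + 1), (d i : ℝ) := by simp [D]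
  rw [← h8]
  linarith

lemma sum_max_sub_div_ge {s N : ℕ} (hN : 1 ≤ N) (hs : s ≤ N + 1) {a : ℝ} (ha : 0 < a)
    (ha1 : a ≤ 1) : s * (a ^ 2 / 8) ≤ ∑ b : Fin s, max 0 (a - (b : ℕ) / N) := by
  rw [Fin.sum_univ_eq_sum_range (fun b : ℕ => max 0 (a - (b : ℝ) / N)) s]
  set t := min s (⌊a * N / 2⌋₊ + 1)
  have hN0 : (0 : ℝ) < N := by exact_mod_cast hN
  have hN1 : (1 : ℝ) ≤ N := by exact_mod_cast hN
  have hs' : (s : ℝ) ≤ N + 1 := by exact_mod_cast hs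
  have h1 : (s : ℝ) * (a / 4) ≤ t := by
    simp only [t, Nat.cast_min, le_min_iff]
    constructor
    · have : (0 : ℝ) ≤ s := by positivity
      nlinarith
    · have := (Nat.lt_floor_add_one (a * N / 2)).le
      push_cast
      refine le_trans ?_ this
      nlinarith
  have h2 : ∑ b ∈ range t, max 0 (a - (b : ℝ) / N) ≤ ∑ b ∈ range s, max 0 (a - (b : ℝ) / N) :=
    Finset.sum_le_sum_of_subset_of_nonneg (range_subset_range.mpr (min_le_left _ _))
      fun _ _ _ => le_max_left _ _
  have h3 : (t : ℝ) * (a / 2) ≤ ∑ b ∈ range t, max 0 (a - (b : ℝ) / N) := by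
    have := Finset.card_nsmul_le_sum (range t) (fun b : ℕ => max 0 (a - (b : ℝ) / N)) (a / 2) (by
      intro b hb
      refine le_max_of_le_right ?_
      have hb1 : b ≤ ⌊a * N / 2⌋₊ := by
        have := (mem_range.mp hb).trans_le (min_le_right _ _)
        omega
      have hb2 : (b : ℝ) ≤ a * N / 2 := (Nat.le_floor_iff (by positivity)).mp hb1
      have : (b : ℝ) / N ≤ a / 2 := by
        rw [div_le_iff₀ hN0]; linarith
      linarith)
    simpa using this
  calc (s : ℝ) * (a ^ 2 / 8) = s * (a / 4) * (a / 2) := by ring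
    _ ≤ t * (a / 2) := by gcongr
    _ ≤ _ := h3.trans h2

lemma ordGe_shift_det {n s : ℕ} {d : ℕ → ℕ} {P : MvPolynomial ℕ ℤ} {r : ℕ → ℚ} {ε δ : ℝ}
    (hsd : s ≤ d n + 1) (hd1 : 1 ≤ d n) (hd : ∀ i < n, (d n : ℝ) ≤ δ * d i)
    (hδ0 : 0 ≤ δ) (hδ : δ < ε) (hε : ε ≤ 1) (Δ Λ : Fin s → (ℕ →₀ ℕ))
    (hΔ1 : ∀ l, (Δ l).degree ≤ l) (hΔ2 : ∀ l, ∀ i, n ≤ i → Δ l i = 0)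
    (hΛ1 : ∀ l, (Λ l) n ≤ l) (hΛ2 : ∀ l, ∀ i, i ≠ n → Λ l i = 0)
    (hP : OrdGe (n + 1) d (shift r (map (Int.castRingHom ℚ) P)) ε) :
    OrdGe (n + 1) d (shift r (map (Int.castRingHom ℚ)
      (Matrix.of fun a b => hasse (Δ a) (hasse (Λ b) P)).det)) (s * ((ε - δ) ^ 2 / 8)) := by
  have hN0 : (0 : ℝ) < d n := by exact_mod_cast hd1
  have h1 : ∀ l, weight (n + 1) d (Δ l) ≤ δ := by
    intro l
    rw [weight, sum_range_succ, hΔ2 l n le_rfl]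
    have h2 : ∀ i ∈ range n, ((Δ l) i : ℝ) / d i ≤ (Δ l) i * (δ / d n) := by
      intro i hi
      have h3 := hd i (mem_range.mp hi)
      rw [div_eq_mul_inv]
      refine mul_le_mul_of_nonneg_left ?_ (by positivity)
      have : (0 : ℝ) < d i := by
        by_contra hh
        have h4 : (d i : ℝ) = 0 := le_antisymm (not_lt.mp hh) (by positivity)
        rw [h4, mul_zero] at h3
        linarith
      rw [inv_le_iff_one_le_mul₀ this, div_mul_eq_mul_div, le_div_iff₀ hN0]
      linarith
    have h3 : ∑ i ∈ range n, (Δ l) i = (Δ l).degree := by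
      rw [Finsupp.degree_apply]
      symm
      refine Finset.sum_subset ?_ ?_
      · intro i hi
        rw [Finsupp.mem_support_iff] at hi
        by_contra hh
        exact hi (hΔ2 l i (by simpa using hh))
      · intro i _ hi
        exact Finsupp.notMem_support_iff.mp hi
    have h4 := Finset.sum_le_sum h2
    rw [← Finset.sum_mul, ← Nat.cast_sum, h3] at h4
    have h5 : ((Δ l).degree : ℝ) ≤ d n := by
      have := hΔ1 l
      have := l.2
      exact_mod_cast (by omega)
    have h6 : ((Δ l).degree : ℝ) * (δ / d n) ≤ d n * (δ / d n) := by gcongr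
    rw [mul_div_cancel₀ _ hN0.ne'] at h6
    simp only [Nat.cast_zero, zero_div, add_zero]
    linarith
  have h2 : ∀ l, weight (n + 1) d (Λ l) ≤ (l : ℕ) / d n := by
    intro l
    rw [weight, sum_range_succ, Finset.sum_eq_zero, zero_add]
    · gcongr
      exact_mod_cast hΛ1 l
    · intro i hi
      rw [hΛ2 l i (by simp at hi; omega)]; simp
  rw [RingHom.map_det, AlgHom.map_det]
  have hord := OrdGe.det (n := n + 1) (d := d) ((shift r).mapMatrix
    ((map (Int.castRingHom ℚ)).mapMatrix (Matrix.of fun a b => hasse (Δ a) (hasse (Λ b) P))))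
    (fun b => max 0 (ε - δ - (b : ℕ) / d n)) (by
      intro a b
      rw [AlgHom.mapMatrix_apply, Matrix.map_apply, RingHom.mapMatrix_apply, Matrix.map_apply,
        Matrix.of_apply, ← hasse_map, ← hasse_map, ← hasse_shift, ← hasse_shift]
      refine (OrdGe.zero_right _).sup fun j hj => le_trans ?_ (((hP.hasse _).hasse _) j hj)
      have := h1 a
      have := h2 b
      linarith)
  exact fun j hj => (sum_max_sub_div_ge hd1 hsd (sub_pos.mpr hδ) (by linarith)).trans (hord j hj)

/-- **Roth's lemma**, in qualitative form. -/
lemma roth_lemma (n : ℕ) : ∀ ε : ℝ, 0 < ε → ∃ δ : ℝ, 0 < δ ∧ ∀ (d : ℕ → ℕ) (r : ℕ → ℚ) (L : ℝ)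
    (P : MvPolynomial ℕ ℤ), P ≠ 0 → BoxSupported n d P → (∀ i < n, 1 ≤ d i) →
    (∀ i, i + 1 < n → (d (i + 1) : ℝ) ≤ δ * d i) → (∀ i < n, L ≤ d i * Real.log (r i).den) →
    (∀ i < n, (d i : ℝ) ≤ δ * L) → Real.log (lOne P : ℤ) ≤ δ * L →
    ∃ j, coeff j (shift r (map (Int.castRingHom ℚ) P)) ≠ 0 ∧ weight n d j ≤ ε := by
  induction n with
  | zero =>
    intro ε hε
    refine ⟨1, one_pos, fun d r L P hP0 hP _ _ _ _ _ => ⟨0, ?_, by rw [weight_zero]; exact hε.le⟩⟩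
    have hC : P = C (coeff 0 P) := by
      ext k
      rw [coeff_C]
      split_ifs with h
      · rw [h]
      · by_contra hne
        apply h
        ext i
        exact ((hP k (mem_support_iff.mpr hne)).1 i (Nat.zero_le i)).symm
    rw [constantCoeff_shift, hC, map_C, eval_C]
    intro h0
    apply hP0
    rw [hC]
    have : coeff 0 P = 0 := by simpa using h0
    rw [this, C_0]
  | succ n ih =>
    intro ε₀ hε₀
    set ε := min ε₀ 1
    have hε : 0 < ε := lt_min hε₀ one_pos
    have hε1 : ε ≤ 1 := min_le_right _ _
    obtain ⟨δ', hδ', hIH⟩ := ih (ε ^ 2 / 100) (by positivity)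
    set K : ℝ := 2 * n + 4
    have hK : 0 < K := by positivity
    set δ := min (ε / 2) (min (δ' / K) (ε ^ 2 / 100 / K))
    have hδ : 0 < δ := lt_min (by positivity) (lt_min (by positivity) (by positivity))
    have hδ1 : δ ≤ ε / 2 := min_le_left _ _
    have hδ2 : K * δ ≤ δ' := by
      have : δ ≤ δ' / K := (min_le_right _ _).trans (min_le_left _ _)
      rw [le_div_iff₀ hK] at this; linarith
    have hδ3 : K * δ ≤ ε ^ 2 / 100 := by
      have : δ ≤ ε ^ 2 / 100 / K := (min_le_right _ _).trans (min_le_right _ _)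
      rw [le_div_iff₀ hK] at this; linarith
    refine ⟨δ, hδ, fun d r L P hP0 hP hd1 hdd hL hdL hPL => ?_⟩
    by_contra! hcon
    have hord : OrdGe (n + 1) d (shift r (map (Int.castRingHom ℚ) P)) ε :=
      fun j hj => (min_le_left _ _).trans (hcon j hj).le
    have hN1 := hd1 n (Nat.lt_succ_self n)
    have hN0 : (0 : ℝ) < d n := by exact_mod_cast hN1
    have hL0 : 0 < L := by
      have := hdL n (Nat.lt_succ_self n)
      by_contra hh
      nlinarith
    have hchain : ∀ i < n, (d n : ℝ) ≤ δ * d i := by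
      intro i hi
      have : ∀ m, i + m + 1 ≤ n → (d (i + m + 1) : ℝ) ≤ δ * d i := by
        intro m
        induction m with
        | zero => intro h; exact hdd i (by omega)
        | succ m ihm =>
          intro h
          have h1 := hdd (i + m + 1) (by omega)
          have h2 := ihm (by omega)
          have h3 : (0 : ℝ) ≤ d (i + m + 1) := by positivity
          have h4 : (d (i + m + 1 + 1) : ℝ) ≤ d (i + m + 1) := by nlinarith
          exact h4.trans h2
      obtain ⟨m, rfl⟩ := Nat.exists_eq_add_of_lt hi
      exact this m le_rfl
    obtain ⟨s, hs1, hsd, Δ, Λ, hΔ1, hΔ2, hΛ1, hΛ2, G, W, hG, hW, hG0, hW0, hGW⟩ :=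
      exists_wronskian_factorization hP0 hP
    have hs0 : (0 : ℝ) < s := by exact_mod_cast hs1
    have hordF := ordGe_shift_det (r := r) hsd hN1 hchain hδ.le (by linarith) hε1 Δ Λ hΔ1 hΔ2
      hΛ1 hΛ2 hord
    have hbox : BoxSupported (n + 1) (fun i => s * d i)
        (Matrix.of fun a b => hasse (Δ a) (hasse (Λ b) P)).det :=
      BoxSupported.det _ fun a b => (hP.hasse _).hasse _
    have hlog := log_lOne_det_hasse_le hP0 hP hs1 hsd Δ Λ
    set F := (Matrix.of fun a b => hasse (Δ a) (hasse (Λ b) P)).det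
    have hF0 : F ≠ 0 := by
      rintro h0
      rw [h0, map_zero] at hGW
      exact (mul_ne_zero hG0 hW0) hGW.symm
    have hlogF : Real.log (lOne F : ℤ) ≤ s * (K * δ * L) := by
      refine (hlog hF0).trans (mul_le_mul_of_nonneg_left ?_ hs0.le)
      have h1 := hdL n (Nat.lt_succ_self n)
      have h2 : ∑ i ∈ range (n + 1), (d i : ℝ) ≤ (n + 1) * (δ * L) := by
        refine (Finset.sum_le_sum fun i hi => hdL i (mem_range.mp hi)).trans ?_
        simp
      simp only [K]
      nlinarith
    have hST : Disjoint (Set.Iio n) ({n} : Set ℕ) := by simp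
    obtain ⟨j₁, hj₁, hj₁w, hj₁S⟩ : ∃ j₁, coeff j₁ (shift r G) ≠ 0 ∧
        weight n (fun i => s * d i) j₁ ≤ ε ^ 2 / 100 ∧ ∀ i, j₁ i ≠ 0 → i ∈ Set.Iio n := by
      obtain ⟨l, hl⟩ := MvPolynomial.ne_zero_iff.mp hW0
      have hlS := mem_supported_iff_coeff.mp hW l hl
      set G₁ := polySlice (Set.Iio n) l F
      have hG₁ : map (Int.castRingHom ℚ) G₁ = C (coeff l W) * G := by
        ext k
        rw [coeff_map, coeff_C_mul]
        by_cases hk : ∀ i, k i ≠ 0 → i ∈ Set.Iio n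
        · rw [coeff_polySlice hk, ← coeff_map, hGW, coeff_add_mul_of_mem_supported hST hG hW hk hlS,
            mul_comm]
        · have e1 : coeff k G₁ = 0 := by
            by_contra hne
            exact hk (mem_supported_iff_coeff.mp (polySlice_mem_supported _ _ _) k hne)
          have e2 : coeff k G = 0 := by
            by_contra hne
            exact hk (mem_supported_iff_coeff.mp hG k hne)
          rw [e1, e2, map_zero, mul_zero]
      have hG₁0 : G₁ ≠ 0 := by
        intro h0
        rw [h0, map_zero, eq_comm, mul_eq_zero, C_eq_zero] at hG₁
        exact hG₁.elim hl hG0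
      obtain ⟨j, hj, hjw⟩ := hIH (fun i => s * d i) r (s * L) G₁ hG₁0 (by
          intro k hk
          have hkS := mem_supported_iff_coeff.mp (polySlice_mem_supported (Set.Iio n) l F) k
            (mem_support_iff.mp hk)
          refine ⟨fun i hi => ?_, fun i => ?_⟩
          · by_contra hne
            have := hkS i hne
            simp at this; omega
          · have h1 := mem_support_iff.mp hk
            rw [coeff_polySlice hkS] at h1
            have h2 := (hbox _ (mem_support_iff.mpr h1)).2 i
            simp only [Finsupp.add_apply] at h2 ⊢
            omega)
        (fun i hi => Nat.mul_pos hs1 (hd1 i (by omega)))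
        (fun i hi => by
          have h1 := hdd i (by omega)
          have h2 : δ * d i ≤ δ' * d i := by
            refine mul_le_mul_of_nonneg_right ?_ (by positivity)
            refine le_trans ?_ hδ2
            have : (1 : ℝ) ≤ K := by
              simp only [K]
              have : (0 : ℝ) ≤ n := by positivity
              linarith
            nlinarith
          push_cast
          have := mul_le_mul_of_nonneg_left (h1.trans h2) hs0.le
          linarith)
        (fun i hi => by
          push_cast
          have := mul_le_mul_of_nonneg_left (hL i (by omega)) hs0.le
          linarith)
        (fun i hi => by
          have h1 := hdL i (by omega)
          have h2 : δ * L ≤ δ' * L := by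
            refine mul_le_mul_of_nonneg_right ?_ hL0.le
            refine le_trans ?_ hδ2
            have : (1 : ℝ) ≤ K := by
              simp only [K]
              have : (0 : ℝ) ≤ n := by positivity
              linarith
            nlinarith
          push_cast
          have := mul_le_mul_of_nonneg_left (h1.trans h2) hs0.le
          linarith)
        (by
          have h1 : ((lOne G₁ : ℤ) : ℝ) ≤ (lOne F : ℤ) := by exact_mod_cast lOne_polySlice_le _ _ _
          have h2 : (0 : ℝ) < (lOne G₁ : ℤ) := by exact_mod_cast lOne_pos hG₁0
          refine (Real.log_le_log h2 h1).trans (hlogF.trans ?_)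
          have h3 : K * δ * L ≤ δ' * L := mul_le_mul_of_nonneg_right hδ2 hL0.le
          have := mul_le_mul_of_nonneg_left h3 hs0.le
          linarith)
      have hj' : coeff j (shift r G) ≠ 0 := by
        rw [hG₁] at hj
        intro h0
        apply hj
        have : shift r (C (coeff l W) : MvPolynomial ℕ ℚ) = C (coeff l W) := by simp [shift]
        rw [map_mul, this, coeff_C_mul, h0, mul_zero]
      exact ⟨j, hj', hjw, mem_supported_iff_coeff.mp (shift_mem_supported hG r) j hj'⟩
    obtain ⟨t, ht, htF⟩ := exists_coeff_single_shift_ne_zero (by simp) hG hW hG0 hW0 hGW r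
    have htw : (t : ℝ) ≤ s * (K * δ) * d n := by
      have hLn := hL n (Nat.lt_succ_self n)
      have hlogpos : 0 < Real.log (r n).den := by
        by_contra hh
        nlinarith
      have hden : (0 : ℝ) < (r n).den := by exact_mod_cast (r n).den_pos
      have h1 : (((r n).den : ℝ)) ^ t ≤ (lOne F : ℤ) := by exact_mod_cast htF
      have h2 := Real.log_le_log (by positivity) h1
      rw [Real.log_pow] at h2
      have h3 : (t : ℝ) * Real.log (r n).den ≤ s * (K * δ) * d n * Real.log (r n).den := by
        calc (t : ℝ) * Real.log (r n).den ≤ s * (K * δ * L) := h2.trans hlogF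
          _ = s * (K * δ) * L := by ring
          _ ≤ s * (K * δ) * (d n * Real.log (r n).den) := by gcongr
          _ = _ := by ring
      exact le_of_mul_le_mul_right h3 hlogpos
    have htS : ∀ i, (Finsupp.single n t) i ≠ 0 → i ∈ ({n} : Set ℕ) := by
      intro i hi
      by_contra hne
      have : n ≠ i := fun h => hne h.symm
      simp [this] at hi
    have hfin := hordF (j₁ + Finsupp.single n t) (by
      rw [hGW, map_mul, coeff_add_mul_of_mem_supported hST (shift_mem_supported hG r)
        (shift_mem_supported hW r) hj₁S htS]
      exact mul_ne_zero hj₁ ht)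
    have hw1 : weight (n + 1) d j₁ = s * weight n (fun i => s * d i) j₁ := by
      have hjn : j₁ n = 0 := by
        by_contra hne
        have := hj₁S n hne
        simp at this
      rw [weight, sum_range_succ, hjn, weight, Finset.mul_sum]
      simp only [Nat.cast_zero, zero_div, add_zero]
      refine Finset.sum_congr rfl fun i _ => ?_
      push_cast
      rw [mul_div_assoc', mul_div_mul_left _ _ hs0.ne']
    have hw2 : weight (n + 1) d (Finsupp.single n t) = t / d n := by
      rw [weight, sum_range_succ, Finset.sum_eq_zero]
      · simp
      · intro i hi
        have : n ≠ i := by simp at hi; omega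
        simp [this]
    rw [weight_add, hw1, hw2] at hfin
    have hw3 : (t : ℝ) / d n ≤ s * (K * δ) := by rw [div_le_iff₀ hN0]; exact htw
    have h1 : (s : ℝ) * ((ε - δ) ^ 2 / 8) ≤ s * (ε ^ 2 / 100 + K * δ) := by
      have := mul_le_mul_of_nonneg_left hj₁w hs0.le
      linarith
    have h2 := le_of_mul_le_mul_left h1 hs0
    have h3 : (ε / 2) ^ 2 ≤ (ε - δ) ^ 2 := by
      apply pow_le_pow_left₀ (by positivity); linarith
    nlinarith [pow_pos hε 2]

end RothLemma

section Counting

lemma sum_exp_half_sub_le {d : ℕ} (hd : 1 ≤ d) (l : ℝ) :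
    ∑ k : Fin (d + 1), Real.exp (l * (1 / 2 - (k : ℝ) / d)) ≤ (d + 1) * Real.exp (l ^ 2 / 8) := by
  have hd0 : (0 : ℝ) < d := by exact_mod_cast hd
  have hrev : ∑ k : Fin (d + 1), Real.exp (l * (1 / 2 - (k : ℝ) / d)) =
      ∑ k : Fin (d + 1), Real.exp (-(l * (1 / 2 - (k : ℝ) / d))) := by
    rw [← Equiv.sum_comp Fin.revPerm]
    refine Finset.sum_congr rfl fun k _ => ?_
    have hk : (k : ℕ) ≤ d := Nat.lt_succ_iff.mp k.2
    congr 1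
    rw [Fin.revPerm_apply, Fin.val_rev, Nat.add_sub_add_right, Nat.cast_sub hk]
    field_simp
    ring
  have hcosh : ∑ k : Fin (d + 1), Real.exp (l * (1 / 2 - (k : ℝ) / d)) =
      ∑ k : Fin (d + 1), Real.cosh (l * (1 / 2 - (k : ℝ) / d)) := by
    simp only [Real.cosh_eq]
    rw [← Finset.sum_div, Finset.sum_add_distrib, ← hrev]
    ring
  rw [hcosh]
  refine (Finset.sum_le_card_nsmul _ _ (Real.exp (l ^ 2 / 8)) fun k _ => ?_).trans ?_
  · refine (Real.cosh_le_exp_half_sq _).trans (Real.exp_le_exp.mpr ?_)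
    have hk : (k : ℝ) / d ≤ 1 := by
      rw [div_le_one hd0]; exact_mod_cast Nat.lt_succ_iff.mp k.2
    have hk0 : 0 ≤ (k : ℝ) / d := by positivity
    have : (1 / 2 - (k : ℝ) / d) ^ 2 ≤ 1 / 4 := by nlinarith
    rw [mul_pow]
    nlinarith [sq_nonneg l]
  · simp

/-- Few points of a box have small normalized coordinate sum. -/
lemma card_sum_div_le {m : ℕ} (d : Fin m → ℕ) (hd : ∀ i, 1 ≤ d i) {η : ℝ} (hη : 0 ≤ η) :
    ((univ.filter fun b : ∀ i : Fin m, Fin (d i + 1) =>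
      ∑ i, ((b i : ℕ) : ℝ) / d i ≤ m / 2 * (1 - η)).card : ℝ) ≤
      (∏ i, ((d i : ℝ) + 1)) * Real.exp (-(m * η ^ 2 / 2)) := by
  set f : (∀ i : Fin m, Fin (d i + 1)) → ℝ := fun b =>
    Real.exp (2 * η * (m / 2 * (1 - η) - ∑ i, ((b i : ℕ) : ℝ) / d i))
  have h1 : ((univ.filter fun b : ∀ i : Fin m, Fin (d i + 1) =>
      ∑ i, ((b i : ℕ) : ℝ) / d i ≤ m / 2 * (1 - η)).card : ℝ) ≤ ∑ b, f b := by
    rw [← nsmul_one]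
    refine (Finset.card_nsmul_le_sum _ f 1 fun b hb => ?_).trans
      (Finset.sum_le_sum_of_subset_of_nonneg (Finset.subset_univ _) fun _ _ _ =>
        (Real.exp_pos _).le)
    refine Real.one_le_exp (mul_nonneg (by positivity) ?_)
    have := (Finset.mem_filter.mp hb).2
    linarith
  have h2 : ∀ b, f b = Real.exp (-(m * η ^ 2)) *
      ∏ i, Real.exp (2 * η * (1 / 2 - ((b i : ℕ) : ℝ) / d i)) := by
    intro b
    rw [← Real.exp_sum, ← Real.exp_add, ← Finset.mul_sum, Finset.sum_sub_distrib]
    simp only [f]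
    congr 1
    simp only [sum_const, card_univ, Fintype.card_fin, nsmul_eq_mul]
    ring
  refine h1.trans ?_
  simp only [h2]
  rw [← Finset.mul_sum, ← Fintype.prod_sum fun i (k : Fin (d i + 1)) => Real.exp (2 * η * (1 / 2 - ((k : ℕ) : ℝ) / d i))]
  have h3 : ∏ i, ∑ k : Fin (d i + 1), Real.exp (2 * η * (1 / 2 - ((k : ℕ) : ℝ) / d i)) ≤
      ∏ i, (((d i : ℝ) + 1) * Real.exp ((2 * η) ^ 2 / 8)) :=
    Finset.prod_le_prod (fun _ _ => Finset.sum_nonneg fun _ _ => (Real.exp_pos _).le)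
      fun i _ => sum_exp_half_sub_le (hd i) _
  refine (mul_le_mul_of_nonneg_left h3 (Real.exp_pos _).le).trans (le_of_eq ?_)
  rw [Finset.prod_mul_distrib, Finset.prod_const, Finset.card_univ, Fintype.card_fin,
    ← Real.exp_nat_mul, mul_left_comm, ← Real.exp_add]
  congr 2
  ring

end Counting

section Siegel

attribute [local instance] Matrix.seminormedAddCommGroup

open Matrix in
/-- Siegel's lemma with at least twice as many unknowns as equations. -/
lemma exists_ne_zero_mulVec_eq_zero {ι κ : Type*} [Fintype ι] [Fintype κ] (A : Matrix ι κ ℤ)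
    (hκ : 0 < Fintype.card κ) (hc : 2 * Fintype.card ι ≤ Fintype.card κ) {H : ℝ} (hH : 1 ≤ H)
    (hA : ∀ i j, |(A i j : ℝ)| ≤ H) :
    ∃ t : κ → ℤ, t ≠ 0 ∧ A *ᵥ t = 0 ∧ ∀ j, |(t j : ℝ)| ≤ Fintype.card κ * H := by
  have hκ1 : (1 : ℝ) ≤ Fintype.card κ := by exact_mod_cast hκ
  rcases Nat.eq_zero_or_pos (Fintype.card ι) with h0 | h0
  · have := Fintype.card_eq_zero_iff.mp h0
    have := Fintype.card_pos_iff.mp hκ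
    refine ⟨1, one_ne_zero, funext fun i => isEmptyElim i, fun j => ?_⟩
    simp only [Pi.one_apply, Int.cast_one, abs_one]
    nlinarith
  · obtain ⟨t, ht0, hAt, ht⟩ := Int.Matrix.exists_ne_zero_int_vec_norm_le A (by omega) h0
    refine ⟨t, ht0, hAt, fun j => ?_⟩
    have hj : |(t j : ℝ)| ≤ ‖t‖ := by
      have := norm_le_pi_norm t j
      rwa [Int.norm_eq_abs] at this
    have hAn : max 1 ‖A‖ ≤ H := by
      refine max_le hH ((Matrix.norm_le_iff (by linarith)).mpr fun i j => ?_)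
      rw [Int.norm_eq_abs]; exact hA i j
    have hb : (1 : ℝ) ≤ Fintype.card κ * max 1 ‖A‖ :=
      one_le_mul_of_one_le_of_one_le hκ1 (le_max_left _ _)
    have hc' : 2 * (Fintype.card ι : ℝ) ≤ Fintype.card κ := by exact_mod_cast hc
    have h0' : (0 : ℝ) < Fintype.card ι := by exact_mod_cast h0
    refine hj.trans (ht.trans ?_)
    refine (Real.rpow_le_rpow_of_exponent_le (z := 1) hb ?_).trans ?_
    · rw [div_le_one (by linarith)]; linarith
    · rw [Real.rpow_one]
      exact mul_le_mul_of_nonneg_left hAn (by positivity)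

end Siegel

section AlgebraicPowers

/-- Uniform integral representation of the powers of an algebraic number. -/
lemma exists_pow_eq_sum {α : ℝ} (hα : IsAlgebraic ℚ α) :
    ∃ (D : ℕ) (C : ℝ), 1 ≤ C ∧ ∀ M : ℕ, ∃ (e : ℝ) (b : ℕ → Fin D → ℤ), e ≠ 0 ∧
      (∀ n ≤ M, e * α ^ n = ∑ s, (b n s : ℝ) * α ^ (s : ℕ)) ∧
      ∀ n ≤ M, ∀ s, |(b n s : ℝ)| ≤ C ^ M := by
  obtain ⟨f, hf0, hf⟩ := (IsFractionRing.isAlgebraic_iff ℤ ℚ ℝ).mpr hα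
  have hdeg : f.natDegree ≠ 0 := by
    intro h
    rw [Polynomial.eq_C_of_natDegree_eq_zero h] at hf hf0
    rw [Polynomial.aeval_C, algebraMap_int_eq, eq_intCast, Int.cast_eq_zero] at hf
    exact hf0 (by rw [hf, Polynomial.C_0])
  obtain ⟨D, hD⟩ := Nat.exists_eq_succ_of_ne_zero hdeg
  set a : ℤ := f.coeff (D + 1) with ha
  have ha0 : a ≠ 0 := by
    rw [ha, ← Nat.succ_eq_add_one, ← hD]
    exact Polynomial.leadingCoeff_ne_zero.mpr hf0
  have hrel : ∑ s : Fin (D + 1), (f.coeff s : ℝ) * α ^ (s : ℕ) = -(a * α ^ (D + 1)) := by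
    rw [Polynomial.aeval_eq_sum_range, hD, Finset.sum_range_succ, Finset.sum_range] at hf
    simp only [zsmul_eq_mul] at hf
    linarith
  set H : ℝ := 1 + ∑ i ∈ range (D + 2), |(f.coeff i : ℝ)|
  have hH : ∀ i < D + 2, |(f.coeff i : ℝ)| ≤ H := by
    intro i hi
    have := Finset.single_le_sum (f := fun i => |(f.coeff i : ℝ)|) (fun _ _ => abs_nonneg _)
      (mem_range.mpr hi)
    linarith
  have hH1 : 1 ≤ H := le_add_of_nonneg_right (Finset.sum_nonneg fun _ _ => abs_nonneg _)
  have key : ∀ n : ℕ, ∃ c : Fin (D + 1) → ℤ, (a : ℝ) ^ n * α ^ n = ∑ s, (c s : ℝ) * α ^ (s : ℕ) ∧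
      ∀ s, |(c s : ℝ)| ≤ (2 * H) ^ n := by
    intro n
    induction n with
    | zero =>
      refine ⟨Fin.cons 1 fun _ => 0, by simp [Fin.sum_univ_succ], fun s => ?_⟩
      refine Fin.cases ?_ (fun s => ?_) s <;> simp
    | succ n ih =>
      obtain ⟨c, hc, hcb⟩ := ih
      refine ⟨fun s => a * Fin.cons (α := fun _ => ℤ) 0 (fun s : Fin D => c s.castSucc) s -
        c (Fin.last D) * f.coeff s, ?_, fun s => ?_⟩
      · rw [pow_succ, pow_succ, mul_mul_mul_comm, hc]
        push_cast
        simp only [sub_mul, Finset.sum_sub_distrib, mul_assoc (c (Fin.last D) : ℝ)]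
        rw [← Finset.mul_sum, hrel, Fin.sum_univ_castSucc, Fin.sum_univ_succ]
        simp only [Fin.cons_zero, Fin.cons_succ, Fin.val_castSucc, Fin.val_last, Fin.val_succ,
          Int.cast_zero]
        rw [add_mul, Finset.sum_mul, mul_zero, zero_mul, zero_add, mul_neg, sub_neg_eq_add]
        congr 1
        · exact Finset.sum_congr rfl fun s _ => by ring
        · ring
      · push_cast
        have hcons : |((Fin.cons (α := fun _ => ℤ) 0 (fun s : Fin D => c s.castSucc) s : ℤ) : ℝ)| ≤
            (2 * H) ^ n := by
          refine Fin.cases ?_ (fun s => ?_) s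
          · simp; positivity
          · simpa using hcb _
        refine (abs_sub _ _).trans ?_
        rw [abs_mul, abs_mul]
        have h1 := mul_le_mul (hH (D + 1) (by omega)) hcons (abs_nonneg _) (by linarith)
        have h2 := mul_le_mul (hcb (Fin.last D)) (hH s (by omega)) (abs_nonneg _) (by positivity)
        rw [pow_succ]
        linarith
  choose c hc hcb using key
  have haH : |(a : ℝ)| ≤ 2 * H := (hH (D + 1) (by omega)).trans (by linarith)
  refine ⟨D + 1, 2 * H, by linarith, fun M => ⟨(a : ℝ) ^ M, fun n s => a ^ (M - n) * c n s,
    pow_ne_zero _ (by exact_mod_cast ha0), fun n hn => ?_, fun n hn s => ?_⟩⟩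
  · push_cast
    simp only [mul_assoc]
    rw [← Finset.mul_sum, ← hc, ← mul_assoc, ← pow_add, Nat.sub_add_cancel hn]
  · push_cast
    rw [abs_mul, abs_pow]
    calc |(a : ℝ)| ^ (M - n) * |(c n s : ℝ)| ≤ (2 * H) ^ (M - n) * (2 * H) ^ n :=
          mul_le_mul (pow_le_pow_left₀ (abs_nonneg _) haH _) (hcb n s) (abs_nonneg _)
            (by positivity)
      _ = (2 * H) ^ M := by rw [← pow_add, Nat.sub_add_cancel hn]

end AlgebraicPowers

section Auxiliary

/-- Extension of a tuple of exponents by zero. -/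
noncomputable def extendExponent {m : ℕ} (b : Fin m → ℕ) : ℕ →₀ ℕ :=
  Finsupp.onFinset (range m) (fun i => if h : i < m then b ⟨i, h⟩ else 0) fun i hi => by
    by_contra h
    simp only [mem_range] at h
    simp [h] at hi

lemma extendExponent_val {m : ℕ} (b : Fin m → ℕ) (i : Fin m) : extendExponent b i = b i := by
  simp [extendExponent]

lemma extendExponent_of_le {m : ℕ} (b : Fin m → ℕ) {i : ℕ} (h : m ≤ i) : extendExponent b i = 0 := by
  simp [extendExponent, not_lt.mpr h]

lemma weight_extendExponent {m : ℕ} (d : ℕ → ℕ) (b : Fin m → ℕ) :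
    weight m d (extendExponent b) = ∑ i : Fin m, (b i : ℝ) / d i := by
  rw [weight, Finset.sum_range]
  simp only [extendExponent_val]

lemma eval_hasse_monomial (α : ℝ) (j k : ℕ →₀ ℕ) (a : ℝ) :
    eval (fun _ => α) (hasse j (monomial k a)) = finsuppChoose k j * a * α ^ (k - j).degree := by
  have : hasse j (monomial k a) = monomial (k - j) ((finsuppChoose k j : ℝ) * a) := by
    by_cases ha : a = 0
    · simp [ha, hasse]
    · rw [hasse, support_monomial, if_neg ha, Finset.sum_singleton, coeff_monomial, if_pos rfl]
  rw [this, eval_monomial, Finsupp.prod, Finset.prod_pow_eq_pow_sum, Finsupp.degree_apply]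

/-- The auxiliary polynomial in Roth's theorem. -/
lemma exists_auxiliary_polynomial {α : ℝ} (hα : IsAlgebraic ℚ α) {η : ℝ} (hη : 0 < η) :
    ∃ (m : ℕ) (C : ℝ), 1 ≤ m ∧ 0 ≤ C ∧ ∀ d : ℕ → ℕ, (∀ i < m, 1 ≤ d i) →
      ∃ P : MvPolynomial ℕ ℤ, P ≠ 0 ∧ BoxSupported m d P ∧
        Real.log (lOne P : ℤ) ≤ C * ∑ i ∈ range m, (d i : ℝ) ∧
        ∀ j, weight m d j ≤ m / 2 * (1 - η) →
          eval (fun _ => α) (hasse j (map (Int.castRingHom ℝ) P)) = 0 := by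
  classical
  obtain ⟨D, C, hC, hpow⟩ := exists_pow_eq_sum hα
  obtain ⟨m, hm1, hm⟩ : ∃ m : ℕ, 1 ≤ m ∧ 2 * D * Real.exp (-(m * η ^ 2 / 2)) ≤ 1 := by
    obtain ⟨m, hm⟩ := exists_nat_ge (4 * D / η ^ 2)
    refine ⟨m + 1, by omega, ?_⟩
    rw [div_le_iff₀ (by positivity)] at hm
    rw [Real.exp_neg, ← div_eq_mul_inv, div_le_one (Real.exp_pos _)]
    have := Real.add_one_le_exp (((m + 1 : ℕ) : ℝ) * η ^ 2 / 2)
    push_cast at this ⊢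
    nlinarith [sq_nonneg η]
  refine ⟨m, Real.log (8 * C), hm1, Real.log_nonneg (by linarith), fun d hd => ?_⟩
  set S := ∑ i ∈ range m, d i with hS
  obtain ⟨e, b, he, hb, hbC⟩ := hpow S
  set κ := ∀ i : Fin m, Fin (d i + 1)
  set T : Finset κ := univ.filter fun k : κ => ∑ i, ((k i : ℕ) : ℝ) / d i ≤ m / 2 * (1 - η) with hT
  set E : κ → ℕ →₀ ℕ := fun k => extendExponent fun i => (k i : ℕ) with hE
  have hE_inj : Function.Injective E := by
    intro k l h
    funext i
    have := DFunLike.congr_fun h (i : ℕ)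
    simp only [hE, extendExponent_val] at this
    exact Fin.ext this
  have hE_le : ∀ k i, E k i ≤ d i := by
    intro k i
    by_cases h : i < m
    · have := extendExponent_val (fun i => (k i : ℕ)) ⟨i, h⟩
      simp only [hE] at this ⊢
      rw [this]
      exact Nat.lt_succ_iff.mp (k ⟨i, h⟩).2
    · simp only [hE]
      rw [extendExponent_of_le _ (not_lt.mp h)]
      exact Nat.zero_le _
  have hE_zero : ∀ k i, m ≤ i → E k i = 0 := fun k i h => extendExponent_of_le _ h
  have hκcard : Fintype.card κ = ∏ i : Fin m, (d i + 1) := by simp [κ, Fintype.card_pi]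
  have hκpos : 0 < Fintype.card κ := by rw [hκcard]; positivity
  have hκ2 : (Fintype.card κ : ℝ) ≤ 2 ^ S := by
    rw [hκcard, hS, Finset.sum_range, ← Finset.prod_pow_eq_pow_sum]
    push_cast
    exact Finset.prod_le_prod (fun _ _ => by positivity) fun i _ => by
      exact_mod_cast Nat.lt_two_pow_self
  have hdeg : ∀ k (j : ℕ →₀ ℕ), (E k - j).degree ≤ S := by
    intro k j
    rw [Finsupp.degree_apply, hS, Finset.sum_subset (s₂ := range m)]
    · refine Finset.sum_le_sum fun i _ => ?_
      rw [Finsupp.tsub_apply]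
      exact (Nat.sub_le _ _).trans (hE_le k i)
    · intro i hi
      by_contra h
      simp only [mem_range, not_lt] at h
      simp [hE_zero k i h] at hi
    · intro i _ hi
      exact Finsupp.notMem_support_iff.mp hi
  have hcard : 2 * Fintype.card (T × Fin D) ≤ Fintype.card κ := by
    have h1 := card_sum_div_le (fun i : Fin m => d i) (fun i => hd i i.2) hη.le
    have h2 : (2 : ℝ) * (T.card * D) ≤ ∏ i : Fin m, ((d i : ℝ) + 1) := by
      have hp : 0 ≤ ∏ i : Fin m, ((d i : ℝ) + 1) := by positivity
      have h3 := mul_le_mul_of_nonneg_right h1 (by positivity : (0 : ℝ) ≤ 2 * D)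
      have h4 := mul_le_mul_of_nonneg_left hm hp
      linarith
    rw [Fintype.card_prod, Fintype.card_coe, Fintype.card_fin, hκcard]
    exact_mod_cast h2
  set A : Matrix (T × Fin D) κ ℤ := fun js k =>
    finsuppChoose (E k) (E js.1) * b (E k - E js.1).degree js.2 with hAdef
  have hA : ∀ js k, |(A js k : ℝ)| ≤ (2 * C) ^ S := by
    intro js k
    simp only [hAdef]
    push_cast
    rw [abs_mul, Nat.abs_cast, mul_pow]
    refine mul_le_mul ?_ (hbC _ (hdeg _ _) _) (abs_nonneg _) (by positivity)
    exact_mod_cast finsuppChoose_le (E k) (E js.1) (hE_le k) (hE_zero k)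
  have h2C : 1 ≤ (2 * C) ^ S := one_le_pow₀ (by linarith)
  obtain ⟨t, ht0, hAt, ht⟩ := exists_ne_zero_mulVec_eq_zero A hκpos hcard h2C hA
  set P : MvPolynomial ℕ ℤ := ∑ k, monomial (E k) (t k) with hP
  have hcoeff : ∀ k, coeff (E k) P = t k := by
    intro k
    rw [hP, coeff_sum]
    simp only [coeff_monomial, hE_inj.eq_iff]
    exact (Finset.sum_ite_eq' univ k t).trans (if_pos (Finset.mem_univ k))
  have hP0 : P ≠ 0 := by
    obtain ⟨k, hk⟩ := Function.ne_iff.mp ht0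
    intro h
    apply hk
    rw [← hcoeff k, h]
    simp
  have hPS : P.support ⊆ univ.image E := by
    intro k hk
    by_contra h
    rw [mem_support_iff] at hk
    apply hk
    rw [hP, coeff_sum]
    refine Finset.sum_eq_zero fun l _ => ?_
    rw [coeff_monomial, if_neg]
    rintro rfl
    exact h (Finset.mem_image_of_mem _ (Finset.mem_univ _))
  refine ⟨P, hP0, ?_, ?_, ?_⟩
  · intro k hk
    obtain ⟨l, -, rfl⟩ := Finset.mem_image.mp (hPS hk)
    exact ⟨hE_zero l, hE_le l⟩
  · have hlpos : (0 : ℝ) < (lOne P : ℤ) := by exact_mod_cast lOne_pos hP0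
    have hle : ((lOne P : ℤ) : ℝ) ≤ (8 * C) ^ S := by
      rw [lOne_eq_sum hPS, Finset.sum_image fun _ _ _ _ h => hE_inj h]
      simp only [hcoeff]
      push_cast
      refine (Finset.sum_le_card_nsmul _ _ _ fun k _ => ht k).trans ?_
      rw [nsmul_eq_mul, Finset.card_univ, ← mul_assoc]
      calc (Fintype.card κ : ℝ) * Fintype.card κ * (2 * C) ^ S ≤ 2 ^ S * 2 ^ S * (2 * C) ^ S := by
            gcongr
        _ = (8 * C) ^ S := by rw [← mul_pow, ← mul_pow]; congr 1; ring
    calc Real.log (lOne P : ℤ) ≤ Real.log ((8 * C) ^ S) := Real.log_le_log hlpos hle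
      _ = Real.log (8 * C) * ∑ i ∈ range m, (d i : ℝ) := by
        rw [Real.log_pow, hS]; push_cast; ring
  · intro j hj
    have hexp : eval (fun _ => α) (hasse j (map (Int.castRingHom ℝ) P)) =
        ∑ k, (finsuppChoose (E k) j : ℝ) * t k * α ^ (E k - j).degree := by
      rw [hP, map_sum, hasse_sum, map_sum]
      refine Finset.sum_congr rfl fun k _ => ?_
      rw [map_monomial, eval_hasse_monomial]
      rfl
    rw [hexp]
    by_cases hjE : ∃ k, E k = j
    · obtain ⟨l, rfl⟩ := hjE
      have hl : l ∈ T := by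
        rw [hT, Finset.mem_filter]
        refine ⟨Finset.mem_univ _, ?_⟩
        simp only [hE] at hj
        rwa [weight_extendExponent] at hj
      apply mul_left_cancel₀ he
      rw [mul_zero, Finset.mul_sum]
      have : ∀ k, e * ((finsuppChoose (E k) (E l) : ℝ) * t k * α ^ (E k - E l).degree) =
          ∑ s, ((A (⟨l, hl⟩, s) k * t k : ℤ) : ℝ) * α ^ (s : ℕ) := by
        intro k
        have h1 := hb _ (hdeg k (E l))
        calc e * ((finsuppChoose (E k) (E l) : ℝ) * t k * α ^ (E k - E l).degree) =
              (finsuppChoose (E k) (E l) : ℝ) * t k * (e * α ^ (E k - E l).degree) := by ring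
          _ = _ := by
            rw [h1, Finset.mul_sum]
            refine Finset.sum_congr rfl fun s _ => ?_
            simp only [hAdef]
            push_cast
            ring
      simp only [this]
      rw [Finset.sum_comm]
      refine Finset.sum_eq_zero fun s _ => ?_
      rw [← Finset.sum_mul, ← Int.cast_sum]
      have h2 := congrFun hAt (⟨l, hl⟩, s)
      simp only [Matrix.mulVec, dotProduct, Pi.zero_apply] at h2
      rw [h2]
      simp
    · refine Finset.sum_eq_zero fun k _ => ?_
      rw [finsuppChoose_eq_zero, Nat.cast_zero, zero_mul, zero_mul]
      intro hjk
      apply hjE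
      have hjk' : ∀ i, j i ≤ E k i := Finsupp.le_def.mp hjk
      refine ⟨fun i => ⟨j i, Nat.lt_succ_iff.mpr ((hjk' i).trans (hE_le k i))⟩, ?_⟩
      ext i
      by_cases h : i < m
      · exact extendExponent_val (fun i : Fin m => j i) ⟨i, h⟩
      · have h3 := hjk' i
        rw [hE_zero k i (not_lt.mp h)] at h3
        rw [hE_zero _ i (not_lt.mp h)]
        omega

end Auxiliary

section Roth

lemma one_le_prod_den_pow_mul_abs_eval {n : ℕ} {d : ℕ → ℕ} {Q : MvPolynomial ℕ ℤ}
    (hQ : BoxSupported n d Q) (r : ℕ → ℚ) (h : eval r (map (Int.castRingHom ℚ) Q) ≠ 0) :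
    1 ≤ (∏ i ∈ range n, ((r i).den : ℚ) ^ d i) * |eval r (map (Int.castRingHom ℚ) Q)| := by
  set D : ℚ := ∏ i ∈ range n, ((r i).den : ℚ) ^ d i with hD
  have hDpos : 0 < D := Finset.prod_pos fun i _ => by have := (r i).den_pos; positivity
  obtain ⟨z, hz⟩ : ∃ z : ℤ, D * eval r (map (Int.castRingHom ℚ) Q) = z := by
    refine ⟨∑ k ∈ Q.support, coeff k Q *
      ∏ i ∈ range n, ((r i).den : ℤ) ^ (d i - k i) * (r i).num ^ k i, ?_⟩
    rw [eval_map, eval₂_eq, Finset.mul_sum]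
    push_cast
    refine Finset.sum_congr rfl fun k hk => ?_
    obtain ⟨hk0, hkd⟩ := hQ k hk
    have hs : ∏ i ∈ k.support, r i ^ k i = ∏ i ∈ range n, r i ^ k i := by
      refine Finset.prod_subset (fun i hi => ?_) fun i _ hi => ?_
      · by_contra hn
        simp only [mem_range, not_lt] at hn
        exact Finsupp.mem_support_iff.mp hi (hk0 i hn)
      · rw [Finsupp.notMem_support_iff.mp hi, pow_zero]
    rw [hs, eq_intCast, mul_left_comm, hD, ← Finset.prod_mul_distrib]
    congr 1
    refine Finset.prod_congr rfl fun i _ => ?_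
    have hne : ((r i).den : ℚ) ≠ 0 := by exact_mod_cast (r i).den_ne_zero
    conv_lhs => rw [← Nat.sub_add_cancel (hkd i), pow_add, mul_assoc, ← mul_pow,
      Rat.den_mul_eq_num]
  have hz0 : z ≠ 0 := by
    rintro rfl
    exact mul_ne_zero hDpos.ne' h (by simpa using hz)
  rw [← abs_of_pos hDpos, ← abs_mul, hz]
  exact_mod_cast Int.one_le_abs hz0

/-- Upper bound for the value of a polynomial with a zero of high order at a nearby point. -/
lemma abs_eval_le_of_weight_le {n : ℕ} {d : ℕ → ℕ} {α : ℝ} {r : ℕ → ℝ} {Q : MvPolynomial ℕ ℝ}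
    {c l : ℝ} (hl : 0 ≤ l) (hr1 : ∀ i, |r i - α| ≤ 1)
    (hr : ∀ i < n, |r i - α| ≤ Real.exp (-(l / d i)))
    (hQ : ∀ k, coeff k (shift (fun _ => α) Q) ≠ 0 → c ≤ weight n d k) :
    |eval r Q| ≤ lOne (shift (fun _ => α) Q) * Real.exp (-(l * c)) := by
  have h1 : eval r Q = eval (fun i => r i - α) (shift (fun _ => α) Q) := by
    rw [← constantCoeff_shift, ← constantCoeff_shift, shift_shift]
    congr 3
    ext i
    simp
  rw [h1, eval_eq, lOne, Finset.sum_mul]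
  refine (Finset.abs_sum_le_sum_abs _ _).trans (Finset.sum_le_sum fun k hk => ?_)
  rw [abs_mul]
  refine mul_le_mul_of_nonneg_left ?_ (abs_nonneg _)
  rw [Finset.abs_prod]
  simp only [abs_pow]
  have h2 : ∏ i ∈ k.support, |r i - α| ^ k i ≤ ∏ i ∈ range n, |r i - α| ^ k i := by
    have e1 : ∏ i ∈ k.support, |r i - α| ^ k i = ∏ i ∈ k.support ∪ range n, |r i - α| ^ k i := by
      refine Finset.prod_subset Finset.subset_union_left fun i _ hi => ?_
      rw [Finsupp.notMem_support_iff.mp hi, pow_zero]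
    rw [e1]
    exact Finset.prod_le_prod_of_subset_of_le_one Finset.subset_union_right
      (fun _ _ => by positivity) fun i _ _ => pow_le_one₀ (abs_nonneg _) (hr1 i)
  refine h2.trans ?_
  calc ∏ i ∈ range n, |r i - α| ^ k i ≤ ∏ i ∈ range n, Real.exp (-(l * ((k i : ℝ) / d i))) := by
        refine Finset.prod_le_prod (fun _ _ => by positivity) fun i hi => ?_
        refine (pow_le_pow_left₀ (abs_nonneg _) (hr i (mem_range.mp hi)) _).trans (le_of_eq ?_)
        rw [← Real.exp_nat_mul]
        congr 1
        ring
    _ = Real.exp (-(l * weight n d k)) := by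
        rw [← Real.exp_sum, weight, Finset.mul_sum, Finset.sum_neg_distrib]
    _ ≤ Real.exp (-(l * c)) := by
        have := mul_le_mul_of_nonneg_left (hQ k (mem_support_iff.mp hk)) hl
        exact Real.exp_le_exp.mpr (by linarith)

lemma exists_lt_den_of_infinite {α : ℝ} {A : Set ℚ} (hA : A.Infinite)
    (hα : ∀ r ∈ A, |α - r| ≤ 1) (N : ℕ) : ∃ r ∈ A, N < r.den := by
  by_contra! h
  apply hA
  obtain ⟨B, hB⟩ := exists_nat_ge (N * (|α| + 1))
  refine Set.Finite.of_finite_image (f := fun r : ℚ => (r.num, r.den))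
    (((Set.finite_Icc (-(B : ℤ)) B).prod (Set.finite_Iic N)).subset ?_) ?_
  · rintro _ ⟨r, hr, rfl⟩
    have hd := h r hr
    have hd0 : (0 : ℝ) < r.den := by exact_mod_cast r.den_pos
    have h1 : |(r : ℝ)| ≤ |α| + 1 := by
      have := abs_sub_abs_le_abs_sub (r : ℝ) α
      rw [abs_sub_comm] at this
      have := hα r hr
      linarith
    have h2 : |(r.num : ℝ)| ≤ B := by
      have h3 : (r.num : ℝ) = r.den * r := by
        have := Rat.den_mul_eq_num r
        exact_mod_cast this.symm
      rw [h3, abs_mul, abs_of_pos hd0]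
      refine le_trans ?_ hB
      exact mul_le_mul (by exact_mod_cast hd) h1 (abs_nonneg _) (by positivity)
    have h3 : |r.num| ≤ (B : ℤ) := by exact_mod_cast h2
    exact ⟨abs_le.mp h3, hd⟩
  · intro r _ s _ hrs
    simp only [Prod.mk.injEq] at hrs
    exact Rat.ext hrs.1 hrs.2

/-- **Roth's theorem**. -/
theorem roth {α : ℝ} (hα : IsAlgebraic ℚ α) {μ : ℝ} (hμ : 2 < μ) :
    {r : ℚ | |α - r| < 1 / (r.den : ℝ) ^ μ}.Finite := by
  by_contra hinf
  set A := {r : ℚ | |α - r| < 1 / (r.den : ℝ) ^ μ} with hA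
  have hden1 : ∀ r : ℚ, (1 : ℝ) ≤ r.den := fun r => by exact_mod_cast r.den_pos
  have hA1 : ∀ r ∈ A, |α - r| ≤ 1 := by
    intro r hr
    refine (le_of_lt hr).trans ?_
    rw [div_le_one (by have := hden1 r; positivity)]
    exact Real.one_le_rpow (hden1 r) (by linarith)
  have hlarge : ∀ x : ℝ, ∃ r ∈ A, x ≤ Real.log r.den := by
    intro x
    obtain ⟨N, hN⟩ := exists_nat_ge (Real.exp x)
    obtain ⟨r, hr, hrN⟩ := exists_lt_den_of_infinite hinf hA1 N
    refine ⟨r, hr, ?_⟩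
    rw [Real.le_log_iff_exp_le (by linarith [hden1 r])]
    exact hN.trans (by exact_mod_cast hrN.le)
  choose f hfA hf using hlarge
  obtain ⟨η, hη, hημ⟩ : ∃ η : ℝ, 0 < η ∧ η * (μ + 2) = (μ - 2) / 2 :=
    ⟨(μ - 2) / (2 * (μ + 2)), div_pos (by linarith) (by linarith), by
      have : μ + 2 ≠ 0 := by linarith
      field_simp⟩
  obtain ⟨m, C, hm1, hC, haux⟩ := exists_auxiliary_polynomial hα hη
  have hm0 : (1 : ℝ) ≤ m := by exact_mod_cast hm1
  set γ : ℝ := m * (μ - 2) / 4 with hγ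
  have hγ0 : 0 < γ := by
    have : 0 < μ - 2 := by linarith
    positivity
  have hμ0 : 0 < μ := by linarith
  obtain ⟨ε, hε, hεγ⟩ : ∃ ε : ℝ, 0 < ε ∧ μ * ε = γ / 4 :=
    ⟨γ / (4 * μ), by positivity, by field_simp⟩
  obtain ⟨δ, hδ, hroth⟩ := roth_lemma m ε hε
  set C' : ℝ := C + Real.log (2 * (2 + |α|)) with hC'
  have hlog : 0 ≤ Real.log (2 * (2 + |α|)) := Real.log_nonneg (by linarith [abs_nonneg α])
  have hC'0 : 0 ≤ C' := by positivity
  obtain ⟨B, hB1, hBδ, hBC, hBC'⟩ : ∃ B : ℝ, 1 ≤ B ∧ 2 ≤ δ * B ∧ 2 * C * m ≤ δ * B ∧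
      C' * (2 * m) ≤ γ / 4 * B := by
    refine ⟨1 + 2 / δ + 2 * C * m / δ + C' * (2 * m) / (γ / 4), ?_, ?_, ?_, ?_⟩
    · have : 0 ≤ 2 / δ + 2 * C * m / δ + C' * (2 * m) / (γ / 4) := by positivity
      linarith
    · have : δ * (1 + 2 / δ + 2 * C * m / δ + C' * (2 * m) / (γ / 4)) =
        2 + (δ + 2 * C * m + δ * (C' * (2 * m) / (γ / 4))) := by field_simp; ring
      rw [this]
      exact le_add_of_nonneg_right (by positivity)
    · have : δ * (1 + 2 / δ + 2 * C * m / δ + C' * (2 * m) / (γ / 4)) =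
        2 * C * m + (δ + 2 + δ * (C' * (2 * m) / (γ / 4))) := by field_simp; ring
      rw [this]
      exact le_add_of_nonneg_right (by positivity)
    · have : γ / 4 * (1 + 2 / δ + 2 * C * m / δ + C' * (2 * m) / (γ / 4)) =
        C' * (2 * m) + γ / 4 * (1 + 2 / δ + 2 * C * m / δ) := by field_simp; ring
      rw [this]
      exact le_add_of_nonneg_right (by positivity)
  have hB0 : 0 < B := by linarith
  set K : ℝ := 2 / δ + 1 with hK
  set r : ℕ → ℚ := fun n => Nat.rec (f B) (fun _ s => f (K * Real.log s.den)) n with hr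
  have hrA : ∀ i, r i ∈ A := by
    intro i
    cases i with
    | zero => exact hfA _
    | succ i => exact hfA _
  set l : ℕ → ℝ := fun i => Real.log (r i).den with hl
  have hlK : ∀ i, K * l i ≤ l (i + 1) := fun i => hf _
  have hlB : ∀ i, B ≤ l i := by
    intro i
    induction i with
    | zero => exact hf _
    | succ i ih =>
      have h1 : 1 ≤ K := by
        have : 0 < 2 / δ := by positivity
        linarith
      have := hlK i
      nlinarith
  have hl0 : ∀ i, 0 < l i := fun i => hB0.trans_le (hlB i)
  obtain ⟨L, hL⟩ : ∃ L : ℝ, B ≤ L ∧ 2 / δ ≤ L ∧ ∀ i < m, 2 * l i / δ ≤ L ∧ l i / η ≤ L := by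
    have hnn : ∀ i ∈ range m, 0 ≤ 2 * l i / δ + l i / η := fun i _ => by
      have := hl0 i
      positivity
    refine ⟨B + 2 / δ + ∑ i ∈ range m, (2 * l i / δ + l i / η), ?_, ?_, ?_⟩
    · have := Finset.sum_nonneg hnn
      have : 0 < 2 / δ := by positivity
      linarith
    · have := Finset.sum_nonneg hnn
      linarith
    · intro i hi
      have h1 := Finset.single_le_sum hnn (mem_range.mpr hi)
      have h2 : 0 < 2 / δ := by positivity
      have h3 := hl0 i
      have h4 : 0 < 2 * l i / δ := by positivity
      have h5 : 0 < l i / η := by positivity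
      constructor <;> linarith
  obtain ⟨hLB, hLδ, hLl⟩ := hL
  have hL0 : 0 < L := hB0.trans_le hLB
  set d : ℕ → ℕ := fun i => ⌈L / l i⌉₊ with hd
  have hd_ge : ∀ i, L / l i ≤ d i := fun i => Nat.le_ceil _
  have hd_le : ∀ i, (d i : ℝ) ≤ L / l i + 1 := fun i =>
    (Nat.ceil_lt_add_one (div_nonneg hL0.le (hl0 i).le)).le
  have hd1 : ∀ i, 1 ≤ d i := fun i => Nat.one_le_ceil_iff.mpr (div_pos hL0 (hl0 i))
  have hd0 : ∀ i, (0 : ℝ) < d i := fun i => by exact_mod_cast hd1 i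
  have hdl : ∀ i, L ≤ d i * l i := fun i => (div_le_iff₀ (hl0 i)).mp (hd_ge i)
  have hdlη : ∀ i < m, d i * l i ≤ (1 + η) * L := by
    intro i hi
    have h1 := mul_le_mul_of_nonneg_right (hd_le i) (hl0 i).le
    rw [add_mul, div_mul_cancel₀ _ (hl0 i).ne', one_mul] at h1
    have h2 := (div_le_iff₀ hη).mp (hLl i hi).2
    linarith
  have hdB : ∀ i, (d i : ℝ) ≤ 2 * L / B := by
    intro i
    have h1 : L / l i ≤ L / B := div_le_div_of_nonneg_left hL0.le hB0 (hlB i)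
    have h2 : 1 ≤ L / B := (one_le_div hB0).mpr hLB
    have := hd_le i
    have h3 : 2 * L / B = L / B + L / B := by ring
    linarith
  have hdsum : ∑ i ∈ range m, (d i : ℝ) ≤ m * (2 * L / B) := by
    have := Finset.sum_le_card_nsmul (range m) (fun i => (d i : ℝ)) _ fun i _ => hdB i
    simpa using this
  obtain ⟨P, hP0, hPbox, hPlog, hPα⟩ := haux d fun i _ => hd1 i
  have c1 : ∀ i, i + 1 < m → (d (i + 1) : ℝ) ≤ δ * d i := by
    intro i hi
    have h1 := (div_le_iff₀ hδ).mp (hLl i (by omega)).1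
    have h2 : L / l (i + 1) ≤ δ * L / (2 * l i) := by
      rw [div_le_div_iff₀ (hl0 (i + 1)) (by have := hl0 i; positivity)]
      have h3 := hlK i
      have h4 : 2 * l i ≤ δ * l (i + 1) := by
        have h5 := mul_le_mul_of_nonneg_left h3 hδ.le
        have h6 : δ * (K * l i) = 2 * l i + δ * l i := by rw [hK]; field_simp
        have := mul_pos hδ (hl0 i)
        linarith
      nlinarith
    have h3 : 1 ≤ δ * L / (2 * l i) := by
      rw [one_le_div (by have := hl0 i; positivity)]
      linarith
    have h4 := mul_le_mul_of_nonneg_left (hd_ge i) hδ.le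
    have h5 : δ * (L / l i) = δ * L / (2 * l i) + δ * L / (2 * l i) := by
      have := (hl0 i).ne'
      field_simp
      ring
    have := hd_le (i + 1)
    linarith
  have c2 : ∀ i < m, (d i : ℝ) ≤ δ * L := by
    intro i _
    refine (hdB i).trans ?_
    rw [div_le_iff₀ hB0]
    nlinarith
  have c3 : Real.log (lOne P : ℤ) ≤ δ * L := by
    refine hPlog.trans ((mul_le_mul_of_nonneg_left hdsum hC).trans ?_)
    have : C * (m * (2 * L / B)) = 2 * C * m * L / B := by ring
    rw [this, div_le_iff₀ hB0]
    have := mul_le_mul_of_nonneg_right hBC hL0.le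
    linarith
  obtain ⟨j, hj0, hjε⟩ := hroth d r L P hP0 hPbox (fun i _ => hd1 i) c1 (fun i _ => hdl i) c2 c3
  set Q := hasse j P with hQ
  have hQbox : BoxSupported m d Q := hPbox.hasse j
  rw [coeff_shift, hasse_map] at hj0
  have hlow := one_le_prod_den_pow_mul_abs_eval hQbox r hj0
  set S := ∑ i ∈ range m, d i with hS
  have hup : |eval (fun i => (r i : ℝ)) (map (Int.castRingHom ℝ) Q)| ≤
      lOne (shift (fun _ => α) (map (Int.castRingHom ℝ) Q)) *
        Real.exp (-(μ * L * (m / 2 * (1 - η) - ε))) := by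
    refine abs_eval_le_of_weight_le (n := m) (d := d) (by positivity) ?_ ?_ ?_
    · intro i
      rw [abs_sub_comm]
      exact hA1 _ (hrA i)
    · intro i _
      rw [abs_sub_comm]
      refine (le_of_lt (hrA i)).trans ?_
      rw [one_div, ← Real.rpow_neg (by linarith [hden1 (r i)]),
        Real.rpow_def_of_pos (by linarith [hden1 (r i)])]
      refine Real.exp_le_exp.mpr ?_
      have h1 : μ * L / d i ≤ μ * l i := by
        rw [div_le_iff₀ (hd0 i)]
        have := mul_le_mul_of_nonneg_left (hdl i) hμ0.le
        linarith
      change l i * -μ ≤ _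
      linarith
    · intro k hk
      by_contra hlt
      apply hk
      rw [hQ, ← hasse_map, ← hasse_shift, coeff_hasse, coeff_shift, hPα, mul_zero]
      rw [weight_add]
      linarith
  have hlone : lOne (shift (fun _ => α) (map (Int.castRingHom ℝ) Q)) ≤
      Real.exp (C' * ∑ i ∈ range m, (d i : ℝ)) := by
    have h1 := lOne_shift_le (a := fun _ : ℕ => α) (b := 2 + |α|) (n := m) (d := d)
      (P := map (Int.castRingHom ℝ) Q) (fun _ => by linarith)
      fun k hk => hQbox k (support_map_subset _ _ hk)
    have h2 : lOne (map (Int.castRingHom ℝ) Q) ≤ 2 ^ S * (lOne P : ℤ) := by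
      rw [lOne_map_intCast]
      exact_mod_cast lOne_hasse_le j hPbox
    have h3 : ((lOne P : ℤ) : ℝ) ≤ Real.exp (C * ∑ i ∈ range m, (d i : ℝ)) := by
      rwa [← Real.log_le_iff_le_exp (by exact_mod_cast lOne_pos hP0)]
    have hb : 0 < 2 + |α| := by positivity
    calc _ ≤ (2 + |α|) ^ S * (2 ^ S * Real.exp (C * ∑ i ∈ range m, (d i : ℝ))) := by
          refine h1.trans (mul_le_mul_of_nonneg_left (h2.trans ?_) (by positivity))
          exact mul_le_mul_of_nonneg_left h3 (by positivity)
      _ = (2 * (2 + |α|)) ^ S * Real.exp (C * ∑ i ∈ range m, (d i : ℝ)) := by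
          rw [mul_pow]; ring
      _ = _ := by
          rw [← Real.exp_log (show 0 < 2 * (2 + |α|) by positivity), ← Real.exp_nat_mul,
            ← Real.exp_add, hC', hS]
          congr 1
          push_cast
          ring
  have hcast : eval (fun i => (r i : ℝ)) (map (Int.castRingHom ℝ) Q) =
      ((eval r (map (Int.castRingHom ℚ) Q) : ℚ) : ℝ) := by
    simp only [eval_map, eval₂_eq, eq_intCast]
    push_cast
    rfl
  have hprod : ∏ i ∈ range m, ((r i).den : ℝ) ^ d i ≤ Real.exp (m * ((1 + η) * L)) := by
    have : ∀ i ∈ range m, ((r i).den : ℝ) ^ d i = Real.exp (d i * l i) := by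
      intro i _
      rw [Real.exp_nat_mul, Real.exp_log (by linarith [hden1 (r i)])]
    rw [Finset.prod_congr rfl this, ← Real.exp_sum]
    refine Real.exp_le_exp.mpr ?_
    have := Finset.sum_le_card_nsmul (range m) (fun i => (d i : ℝ) * l i) _
      fun i hi => hdlη i (mem_range.mp hi)
    simpa using this
  have hlow' : (1 : ℝ) ≤ (∏ i ∈ range m, ((r i).den : ℝ) ^ d i) *
      |eval (fun i => (r i : ℝ)) (map (Int.castRingHom ℝ) Q)| := by
    rw [hcast]
    exact_mod_cast hlow
  have hfin : (1 : ℝ) ≤ Real.exp (m * ((1 + η) * L)) *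
      (Real.exp (C' * ∑ i ∈ range m, (d i : ℝ)) *
        Real.exp (-(μ * L * (m / 2 * (1 - η) - ε)))) := by
    refine hlow'.trans (mul_le_mul hprod (hup.trans ?_) (abs_nonneg _) (Real.exp_pos _).le)
    exact mul_le_mul_of_nonneg_right hlone (Real.exp_pos _).le
  rw [← Real.exp_add, ← Real.exp_add, Real.one_le_exp_iff] at hfin
  have h4 : C' * ∑ i ∈ range m, (d i : ℝ) ≤ γ / 4 * L := by
    refine (mul_le_mul_of_nonneg_left hdsum hC'0).trans ?_
    have : C' * (m * (2 * L / B)) = C' * (2 * m) * L / B := by ring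
    rw [this, div_le_iff₀ hB0]
    have := mul_le_mul_of_nonneg_right hBC' hL0.le
    linarith
  have h5 : μ * (m / 2 * (1 - η)) - m * (1 + η) = γ := by
    have : μ * (m / 2 * (1 - η)) - m * (1 + η) = m / 2 * (μ - 2 - η * (μ + 2)) := by ring
    rw [this, hημ, hγ]
    ring
  have h6 : m * ((1 + η) * L) + (C' * ∑ i ∈ range m, (d i : ℝ) +
      -(μ * L * (m / 2 * (1 - η) - ε))) =
      C' * ∑ i ∈ range m, (d i : ℝ) - (μ * (m / 2 * (1 - η)) - m * (1 + η)) * L + μ * ε * L := by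
    ring
  rw [h6, h5, hεγ] at hfin
  nlinarith [mul_pos hγ0 hL0]

end Roth

section Pierce

lemma pow_lt_of_log_recurrence {l : ℕ → ℝ} (hl : ∀ n, 0 < l n) (h0 : 2 * l 0 ≤ l 1)
    (hrec : ∀ n, 3 * l (n + 1) ≤ l (n + 2) + l n) {μ : ℝ} (hμ : μ < (3 + Real.sqrt 5) / 2) :
    ∃ N, ∀ n ≥ N, μ * l n < l (n + 1) := by
  set ψ := (3 + Real.sqrt 5) / 2 with hψ
  have hsq : Real.sqrt 5 ^ 2 = 5 := Real.sq_sqrt (by norm_num)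
  have hψ2 : ψ ^ 2 = 3 * ψ - 1 := by rw [hψ]; nlinarith
  have hs1 : 2 ≤ Real.sqrt 5 := Real.le_sqrt_of_sq_le (by norm_num)
  have hs2 : Real.sqrt 5 ≤ 3 := Real.sqrt_le_iff.mpr (by norm_num)
  have h1 : 5 / 2 ≤ ψ := by rw [hψ]; linarith
  have h2 : ψ ≤ 3 := by rw [hψ]; linarith
  have key : ∀ n, (ψ - (1 / 2) ^ n) * l n ≤ l (n + 1) := by
    intro n
    induction n with
    | zero =>
      have := hl 0
      simp only [pow_zero, zero_add]
      nlinarith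
    | succ n ih =>
      set e : ℝ := (1 / 2) ^ n with he
      have he0 : 0 < e := by positivity
      have he1 : e ≤ 1 := pow_le_one₀ (by norm_num) (by norm_num)
      have hc : 0 < 3 - ψ + e / 2 := by linarith
      have h3 := mul_le_mul_of_nonneg_left ih hc.le
      have h4 : 1 ≤ (3 - ψ + e / 2) * (ψ - e) := by nlinarith
      have h5 := mul_le_mul_of_nonneg_right h4 (hl n).le
      have h6 := hrec n
      rw [pow_succ, ← he]
      nlinarith
  obtain ⟨N, hN⟩ := exists_pow_lt_of_lt_one (sub_pos.mpr hμ) (by norm_num : (1 / 2 : ℝ) < 1)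
  refine ⟨N, fun n hn => (mul_lt_mul_of_pos_right ?_ (hl n)).trans_le (key n)⟩
  have := pow_le_pow_of_le_one (by norm_num : (0 : ℝ) ≤ 1 / 2) (by norm_num) hn
  linarith

lemma abs_tsum_alternating {b : ℕ → ℝ} (hb : ∀ n, 0 < b n) (hb3 : ∀ n, 3 * b (n + 1) ≤ b n) :
    Summable (fun n => (-1) ^ n * b n) ∧
      b 0 - b 1 ≤ ∑' n, (-1) ^ n * b n ∧ ∑' n, (-1) ^ n * b n ≤ b 0 := by
  have hanti : Antitone b := antitone_nat_of_succ_le fun n => by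
    have := hb3 n
    have := hb (n + 1)
    linarith
  have hle : ∀ n, b n ≤ (1 / 3) ^ n * b 0 := by
    intro n
    induction n with
    | zero => simp
    | succ n ih => rw [pow_succ]; linarith [hb3 n]
  have hsum : Summable (fun n => (-1) ^ n * b n) := by
    refine Summable.of_norm_bounded
      ((summable_geometric_of_lt_one (by norm_num : (0 : ℝ) ≤ 1 / 3) (by norm_num)).mul_right (b 0))
      fun n => ?_
    rw [norm_mul, norm_pow, norm_neg, norm_one, one_pow, one_mul, Real.norm_eq_abs,
      abs_of_pos (hb n)]
    exact hle n
  have ht := hsum.hasSum.tendsto_sum_nat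
  refine ⟨hsum, ?_, ?_⟩
  · have := hanti.alternating_series_le_tendsto ht 1
    simpa [Finset.sum_range_succ, sub_eq_add_neg] using this
  · have := hanti.tendsto_le_alternating_series ht 0
    simpa using this

variable {X Y U : ℕ → ℤ}

lemma two_le_and_one_le (hX0 : 2 ≤ X 0) (hY0 : 1 ≤ Y 0) (hU : ∀ n, 1 ≤ U n)
    (hY : ∀ n, Y (n + 1) = Y n * (1 + U n * X n)) (hX : ∀ n, X (n + 1) = X n * Y (n + 1)) (n : ℕ) :
    2 ≤ X n ∧ 1 ≤ Y n := by
  induction n with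
  | zero => exact ⟨hX0, hY0⟩
  | succ n ih =>
    have h1 : 1 ≤ Y (n + 1) := by
      rw [hY]
      nlinarith [ih.1, ih.2, mul_pos (by linarith [hU n] : 0 < U n) (by linarith [ih.1] : 0 < X n)]
    refine ⟨?_, h1⟩
    rw [hX]
    nlinarith [ih.1]

lemma add_one_le_succ (hX0 : 2 ≤ X 0) (hY0 : 1 ≤ Y 0) (hU : ∀ n, 1 ≤ U n)
    (hY : ∀ n, Y (n + 1) = Y n * (1 + U n * X n)) (hX : ∀ n, X (n + 1) = X n * Y (n + 1)) (n : ℕ) :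
    1 + X n ≤ Y (n + 1) := by
  obtain ⟨h1, h2⟩ := two_le_and_one_le hX0 hY0 hU hY hX n
  rw [hY]
  have h3 : X n ≤ U n * X n := by nlinarith [hU n]
  nlinarith

lemma exists_rational_approximations (hX0 : 2 ≤ X 0) (hY0 : 1 ≤ Y 0) (hU : ∀ n, 1 ≤ U n)
    (hY : ∀ n, Y (n + 1) = Y n * (1 + U n * X n)) (hX : ∀ n, X (n + 1) = X n * Y (n + 1))
    (p : ℤ) {α : ℝ} (hα : α = (p : ℝ) / X 0 + ∑' j : ℕ, (-1 : ℝ) ^ j / X (j + 1)) :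
    ∃ P : ℕ → ℤ, (∀ n, 0 < |α - (P n : ℝ) / X n| ∧ |α - (P n : ℝ) / X n| ≤ 1 / X (n + 1)) ∧
      StrictAnti fun n => |α - (P n : ℝ) / X n| := by
  have hpos := two_le_and_one_le hX0 hY0 hU hY hX
  have hgrow := add_one_le_succ hX0 hY0 hU hY hX
  have hXr : ∀ n, (0 : ℝ) < X n := fun n => by exact_mod_cast (by linarith [(hpos n).1] : 0 < X n)
  have hXne : ∀ n, (X n : ℝ) ≠ 0 := fun n => (hXr n).ne'
  set b : ℕ → ℝ := fun n => 1 / X (n + 1) with hb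
  have hb0 : ∀ n, 0 < b n := fun n => one_div_pos.mpr (hXr _)
  have hb3 : ∀ n, 3 * b (n + 1) ≤ b n := by
    intro n
    have h1 : 3 * X (n + 1) ≤ X (n + 1 + 1) := by
      rw [hX (n + 1)]
      nlinarith [hgrow (n + 1), (hpos (n + 1)).1]
    have h2 : 3 * (X (n + 1) : ℝ) ≤ X (n + 1 + 1) := by exact_mod_cast h1
    simp only [hb]
    rw [mul_one_div, div_le_div_iff₀ (hXr _) (hXr _)]
    linarith
  have hab : ∀ j : ℕ, (-1 : ℝ) ^ j / X (j + 1) = (-1) ^ j * b j := fun j => by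
    rw [hb]; ring
  simp only [hab] at hα
  set P : ℕ → ℤ := fun n => Nat.rec p (fun n s => s * Y (n + 1) + (-1) ^ n) n with hP
  have hPX : ∀ n, (P n : ℝ) / X n = p / X 0 + ∑ j ∈ range n, (-1) ^ j * b j := by
    intro n
    induction n with
    | zero => simp [hP]
    | succ n ih =>
      have h1 : P (n + 1) = P n * Y (n + 1) + (-1) ^ n := rfl
      rw [Finset.sum_range_succ, ← add_assoc, ← ih, h1, ← hab, hX]
      have := hXne n
      have h2 : (Y (n + 1) : ℝ) ≠ 0 := by
        have := (hpos (n + 1)).2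
        exact_mod_cast (by linarith : 0 < Y (n + 1)).ne'
      push_cast
      field_simp
  have herr : ∀ n, |α - (P n : ℝ) / X n| = ∑' j, (-1) ^ j * b (n + j) := by
    intro n
    have h1 : α - (P n : ℝ) / X n = (-1) ^ n * ∑' j, (-1) ^ j * b (n + j) := by
      rw [hPX, hα, ← (abs_tsum_alternating hb0 hb3).1.sum_add_tsum_nat_add n, ← tsum_mul_left]
      have : ∀ j, (-1 : ℝ) ^ (j + n) * b (j + n) = (-1) ^ n * ((-1) ^ j * b (n + j)) := fun j => by
        rw [add_comm n j]; ring
      simp only [this]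
      ring
    rw [h1, abs_mul, abs_pow, abs_neg, abs_one, one_pow, one_mul, abs_of_nonneg]
    have h2 := (abs_tsum_alternating (b := fun j => b (n + j)) (fun j => hb0 _) fun j => hb3 _).2.1
    have h3 := hb3 n
    have h4 := hb0 (n + 1)
    simp only [add_zero] at h2
    linarith
  have hbounds : ∀ n, b n - b (n + 1) ≤ |α - (P n : ℝ) / X n| ∧ |α - (P n : ℝ) / X n| ≤ b n := by
    intro n
    rw [herr]
    exact (abs_tsum_alternating (b := fun j => b (n + j)) (fun j => hb0 _) fun j => hb3 _).2
  refine ⟨P, fun n => ⟨?_, (hbounds n).2⟩, strictAnti_nat_of_succ_lt fun n => ?_⟩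
  · have h3 := hb3 n
    have h4 := hb0 (n + 1)
    linarith [(hbounds n).1]
  · have h3 := hb3 n
    have h4 := hb0 (n + 1)
    linarith [(hbounds n).1, (hbounds (n + 1)).2]

lemma exists_forall_rpow_lt (hX0 : 2 ≤ X 0) (hY0 : 1 ≤ Y 0) (hU : ∀ n, 1 ≤ U n)
    (hY : ∀ n, Y (n + 1) = Y n * (1 + U n * X n)) (hX : ∀ n, X (n + 1) = X n * Y (n + 1))
    {μ : ℝ} (hμ : μ < (3 + Real.sqrt 5) / 2) :
    ∃ N, ∀ n ≥ N, (X n : ℝ) ^ μ < X (n + 1) := by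
  have hpos := two_le_and_one_le hX0 hY0 hU hY hX
  have hgrow := add_one_le_succ hX0 hY0 hU hY hX
  have hX2 : ∀ n, (2 : ℝ) ≤ X n := fun n => by exact_mod_cast (hpos n).1
  have hXr : ∀ n, (0 : ℝ) < X n := fun n => by linarith [hX2 n]
  have hXne : ∀ n, (X n : ℝ) ≠ 0 := fun n => (hXr n).ne'
  have hinit : 2 * Real.log (X 0) ≤ Real.log (X 1) := by
    have h1 : X 0 ^ 2 ≤ X 1 := by
      have := hgrow 0
      rw [hX 0]
      nlinarith
    have h2 := Real.log_le_log (pow_pos (hXr 0) 2) (by exact_mod_cast h1 : (X 0 : ℝ) ^ 2 ≤ X 1)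
    rw [Real.log_pow] at h2
    exact_mod_cast h2
  have hrec : ∀ n, 3 * Real.log (X (n + 1)) ≤ Real.log (X (n + 2)) + Real.log (X n) := by
    intro n
    have h1 : X (n + 1) ^ 3 ≤ X (n + 2) * X n := by
      have h3 : X (n + 2) * X n = X (n + 1) ^ 2 * (1 + U (n + 1) * X (n + 1)) := by
        rw [hX (n + 1), hY (n + 1), hX n]
        ring
      have h4 : X (n + 1) ≤ 1 + U (n + 1) * X (n + 1) := by
        nlinarith [hU (n + 1), (hpos (n + 1)).1]
      rw [h3, pow_succ]
      exact mul_le_mul_of_nonneg_left h4 (sq_nonneg _)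
    have h2 := Real.log_le_log (pow_pos (hXr (n + 1)) 3)
      (by exact_mod_cast h1 : (X (n + 1) : ℝ) ^ 3 ≤ X (n + 2) * X n)
    rw [Real.log_pow, Real.log_mul (hXne _) (hXne _)] at h2
    exact_mod_cast h2
  obtain ⟨N, hN⟩ := pow_lt_of_log_recurrence (l := fun n => Real.log (X n))
    (fun n => Real.log_pos (by linarith [hX2 n])) hinit hrec hμ
  refine ⟨N, fun n hn => ?_⟩
  rw [← Real.log_lt_log_iff (Real.rpow_pos_of_pos (hXr n) _) (hXr _), Real.log_rpow (hXr n)]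
  exact hN n hn

lemma one_le_convergent_denominator {k : ℕ} {a qc : ℕ → ℤ}
    (ha : ∀ j, 1 ≤ j → j ≤ 2 * k → 1 ≤ a j) (hqc0 : qc 0 = 1) (hqc1 : qc 1 = 0)
    (hqc : ∀ n, qc (n + 2) = a n * qc (n + 1) + qc n) (n : ℕ) (hn : n ≤ 2 * k) :
    0 ≤ qc (n + 1) ∧ 1 ≤ qc (n + 2) := by
  induction n with
  | zero => simp [hqc, hqc0, hqc1]
  | succ n ih =>
    obtain ⟨h1, h2⟩ := ih (by omega)
    have h3 := ha (n + 1) (by omega) hn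
    refine ⟨by linarith, ?_⟩
    rw [hqc (n + 1)]
    nlinarith

/-- A number with unboundedly good approximations of exponent larger than two is transcendental. -/
lemma transcendental_of_approximations {α μ : ℝ} (hμ : 2 < μ) {P X : ℕ → ℤ} (hX : ∀ n, 0 < X n)
    (hanti : StrictAnti fun n => |α - (P n : ℝ) / X n|)
    (h : ∀ n, |α - (P n : ℝ) / X n| < 1 / (X n : ℝ) ^ μ) : Transcendental ℚ α := by
  intro halg
  refine Set.infinite_of_injective_forall_mem (f := fun n => (P n : ℚ) / X n) ?_ (fun n => ?_)
    (roth halg hμ)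
  · intro i j hij
    apply hanti.injective
    have : ((P i : ℚ) / X i : ℝ) = (P j : ℚ) / X j := by
      have := congrArg (fun q : ℚ => (q : ℝ)) hij
      simpa using this
    simp only [Rat.cast_intCast] at this
    simp only [this]
  · have hd : ((((P n : ℚ) / X n).den : ℕ) : ℤ) ≤ X n :=
      Int.le_of_dvd (hX n) (by rw [← Rat.divInt_eq_div]; exact Rat.den_dvd _ _)
    have hd' : ((((P n : ℚ) / X n).den : ℕ) : ℝ) ≤ X n := by exact_mod_cast hd
    have hd0 : (0 : ℝ) < ((P n : ℚ) / X n).den := by exact_mod_cast ((P n : ℚ) / X n).den_pos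
    have hn := h n
    refine lt_of_lt_of_le (b := 1 / (X n : ℝ) ^ μ) (by push_cast; exact hn) ?_
    exact one_div_le_one_div_of_le (Real.rpow_pos_of_pos hd0 _)
      (Real.rpow_le_rpow hd0.le hd' (by linarith))

end Pierce

end RothTheorem

/-- **Corollary 3.2 (Pierce-added case).**  The number `α = p/q + ∑_{j≥2} (-1)^j/x_j` of
Theorem 2.2 is transcendental, and its irrationality exponent is at least `(3 + √5)/2`: for
every `μ < (3 + √5)/2` there are infinitely many rationals `P/Q` with
`0 < |α - P/Q| < 1/Q^μ`. -/
theorem pierce_added_transcendental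
    (k : ℕ) (a : ℕ → ℤ) (ha : ∀ j, 1 ≤ j → j ≤ 2 * k → 1 ≤ a j)
    (pc qc : ℕ → ℤ)
    (hpc0 : pc 0 = 0) (hpc1 : pc 1 = 1) (hqc0 : qc 0 = 1) (hqc1 : qc 1 = 0)
    (hpc : ∀ n, pc (n + 2) = a n * pc (n + 1) + pc n)
    (hqc : ∀ n, qc (n + 2) = a n * qc (n + 1) + qc n)
    (p q : ℤ) (hq : 1 < q) (hcop : Int.gcd p q = 1)
    (hp : p = pc (2 * k + 2)) (hqv : q = qc (2 * k + 2))
    (m : ℤ) (hm : 0 ≤ m) (hm1 : qc (2 * k + 1) = 1 → 1 ≤ m)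
    (u x y : ℕ → ℤ) (hu : ∀ n, 1 ≤ n → 1 ≤ u n)
    (hx1 : x 1 = q) (hy0 : y 0 = m * q + qc (2 * k + 1) - 1)
    (hrec : ∀ j, 1 ≤ j → y j = y (j - 1) * (1 + u j * x j) ∧ x (j + 1) = x j * y j)
    (α : ℝ) (hα : α = (p : ℝ) / (q : ℝ) + ∑' j : ℕ, (-1 : ℝ) ^ j / (x (j + 2) : ℝ)) :
    Transcendental ℚ α ∧
      ∀ μ : ℝ, μ < (3 + Real.sqrt 5) / 2 → (approxSet α μ).Infinite := by
  have hq_pos := one_le_convergent_denominator ha hqc0 hqc1 hqc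
  have hk : 1 ≤ k := by
    by_contra h
    obtain rfl : k = 0 := by omega
    rw [hqv, Nat.mul_zero, zero_add, hqc, hqc0, hqc1] at hq
    simp at hq
  have hq1 : 1 ≤ qc (2 * k + 1) := by
    have := (hq_pos (2 * k - 1) (by omega)).2
    rwa [show 2 * k - 1 + 2 = 2 * k + 1 by omega] at this
  have hy1 : 1 ≤ y 0 := by
    rw [hy0]
    rcases hq1.eq_or_lt with h | h
    · nlinarith [hm1 h.symm]
    · nlinarith
  have hX0 : 2 ≤ x (0 + 1) := by rw [zero_add, hx1]; omega
  have hU : ∀ n, 1 ≤ u (n + 1) := fun n => hu _ (by omega)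
  have hY : ∀ n, y (n + 1) = y n * (1 + u (n + 1) * x (n + 1)) := fun n =>
    (hrec (n + 1) (by omega)).1
  have hX : ∀ n, x (n + 1 + 1) = x (n + 1) * y (n + 1) := fun n => (hrec (n + 1) (by omega)).2
  have hpos : ∀ n, 0 < x (n + 1) := fun n => by
    linarith [(two_le_and_one_le (X := fun n => x (n + 1)) (U := fun n => u (n + 1)) hX0 hy1 hU hY
      hX n).1]
  obtain ⟨P, hP, hanti⟩ := exists_rational_approximations (X := fun n => x (n + 1))
    (U := fun n => u (n + 1)) hX0 hy1 hU hY hX p (α := α) (by rw [hα, zero_add, hx1])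
  have happrox : ∀ μ : ℝ, μ < (3 + Real.sqrt 5) / 2 → ∃ N, ∀ n,
      |α - (P (n + N) : ℝ) / x (n + N + 1)| < 1 / (x (n + N + 1) : ℝ) ^ μ := by
    intro μ hμ
    obtain ⟨N, hN⟩ := exists_forall_rpow_lt (X := fun n => x (n + 1)) (U := fun n => u (n + 1))
      hX0 hy1 hU hY hX hμ
    refine ⟨N, fun n => (hP (n + N)).2.trans_lt ?_⟩
    refine one_div_lt_one_div_of_lt (Real.rpow_pos_of_pos ?_ _) (hN _ (by omega))
    exact_mod_cast hpos _
  have hshift : ∀ N, StrictAnti fun n => |α - (P (n + N) : ℝ) / x (n + N + 1)| := fun N i j hij =>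
    hanti (by omega : i + N < j + N)
  constructor
  · have h5 : (5 / 2 : ℝ) < (3 + Real.sqrt 5) / 2 := by
      have : 2 < Real.sqrt 5 := Real.lt_sqrt_of_sq_lt (by norm_num)
      linarith
    obtain ⟨N, hN⟩ := happrox _ h5
    exact transcendental_of_approximations (by norm_num) (fun n => hpos (n + N)) (hshift N) hN
  · intro μ hμ
    obtain ⟨N, hN⟩ := happrox μ hμ
    refine Set.infinite_of_injective_forall_mem
      (f := fun n => (P (n + N), x (n + N + 1))) (fun i j hij => ?_) fun n =>
      ⟨hpos (n + N), (hP (n + N)).1, hN n⟩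
    simp only [Prod.mk.injEq] at hij
    apply (hshift N).injective
    simp only [hij.1, hij.2]
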